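/- Let n ≥ 3 and p > (n−1)/2. There is a constant C > 0, depending only on n and p, such that for every measurable V : ℝ^n → ℂ with ‖V‖_{F^p} < ∞ and every Schwartz function f on ℝ^n, ‖ cos(t√−Δ) f ‖_{L²_{x,t}(|V|)} ≤ C ‖V‖_{F^p}^{1/2} ‖(√−Δ)^{1/2} f‖_{L²(ℝ^n)}. -/

import Mathlib

noncomputable section

open MeasureTheory Metric Complex
open scoped ENNReal FourierTransform SchwartzMap

/-- The Fourier multiplier operator `m(√−Δ)` on `ℝⁿ`:
`m(√−Δ)h = 𝓕⁻¹(m(|ξ|) 𝓕h(ξ))`. -/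
def mOp (n : ℕ) (m : ℝ → ℂ) (h : EuclideanSpace ℝ (Fin n) → ℂ) :
    EuclideanSpace ℝ (Fin n) → ℂ :=
  fun x => 𝓕⁻ (fun ξ : EuclideanSpace ℝ (Fin n) => m ‖ξ‖ * 𝓕 h ξ) x

/-- The multiplier of `e^{it√−Δ}`, i.e. `ρ ↦ e^{itρ}`. -/
def expMult (t : ℝ) : ℝ → ℂ := fun ρ => Complex.exp (Complex.I * t * ρ)

/-- The multiplier of `cos(t√−Δ)`, i.e. `ρ ↦ cos (tρ)`. -/
def cosMult (t : ℝ) : ℝ → ℂ := fun ρ => ((Real.cos (t * ρ) : ℝ) : ℂ)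

/-- The multiplier of `sin(t√−Δ)/√−Δ`, i.e. `ρ ↦ sin (tρ)/ρ`. -/
def sincMult (t : ℝ) : ℝ → ℂ := fun ρ => ((Real.sin (t * ρ) / ρ : ℝ) : ℂ)

/-- The multiplier of `sin(t√−Δ)`, i.e. `ρ ↦ sin (tρ)`. -/
def sinMult (t : ℝ) : ℝ → ℂ := fun ρ => ((Real.sin (t * ρ) : ℝ) : ℂ)

/-- The multiplier of `(√−Δ)^γ`, i.e. `ρ ↦ ρ^γ`. -/
def powMult (γ : ℝ) : ℝ → ℂ := fun ρ => ((ρ ^ γ : ℝ) : ℂ)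

/-- A function is Schwartz if it agrees pointwise with some Schwartz map. -/
def IsSchwartz {n : ℕ} (h : EuclideanSpace ℝ (Fin n) → ℂ) : Prop :=
  ∃ φ : 𝓢(EuclideanSpace ℝ (Fin n), ℂ), ∀ x, h x = φ x

/-- The Fefferman–Phong norm
`‖V‖_{𝓕^p} = sup_{x, r>0} r^(2-n/p) (∫_{B_r(x)} |V|^p)^(1/p)`. -/
def fpNorm (n : ℕ) (p : ℝ) (V : EuclideanSpace ℝ (Fin n) → ℂ) : ℝ≥0∞ :=
  ⨆ (x : EuclideanSpace ℝ (Fin n)) (r : ℝ) (_ : 0 < r),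
    ENNReal.ofReal (r ^ (2 - n / p)) *
      (∫⁻ y in ball x r, ENNReal.ofReal (‖V y‖ ^ p)) ^ (1 / p)

/-- The weak `L^{n/2}` quasinorm `sup_{λ>0} λ · |{|V| > λ}|^{2/n}`. -/
def wkNorm (n : ℕ) (V : EuclideanSpace ℝ (Fin n) → ℂ) : ℝ≥0∞ :=
  ⨆ (l : ℝ) (_ : 0 < l),
    ENNReal.ofReal l * (volume {x : EuclideanSpace ℝ (Fin n) | l < ‖V x‖}) ^ ((2 : ℝ) / n)

/-- The mixed norm `‖F‖_{L^q_t L^r_x}` for `F : ℝⁿ × ℝ → ℂ`, curried as `F x t`. -/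
def mixedNorm (n : ℕ) (q r : ℝ) (F : EuclideanSpace ℝ (Fin n) → ℝ → ℂ) : ℝ≥0∞ :=
  (∫⁻ t : ℝ, (∫⁻ x : EuclideanSpace ℝ (Fin n), (‖F x t‖₊ : ℝ≥0∞) ^ r) ^ (q / r)) ^ (1 / q)

/-- The weighted norm `‖h‖_{L²_{x,t}(w)}` with weight `w : ℝⁿ → [0,∞]`. -/
def wtNorm (n : ℕ) (w : EuclideanSpace ℝ (Fin n) → ℝ≥0∞)
    (h : EuclideanSpace ℝ (Fin n) → ℝ → ℂ) : ℝ≥0∞ :=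
  (∫⁻ t : ℝ, ∫⁻ x : EuclideanSpace ℝ (Fin n), (‖h x t‖₊ : ℝ≥0∞) ^ (2 : ℝ) * w x) ^ ((1 : ℝ) / 2)

/-- The homogeneous Sobolev norm `‖h‖_{Ḣ^γ} = ‖(√−Δ)^γ h‖_{L²}`. -/
def sobNorm (n : ℕ) (γ : ℝ) (h : EuclideanSpace ℝ (Fin n) → ℂ) : ℝ≥0∞ :=
  eLpNorm (mOp n (powMult γ) h) 2 volume

/-- The point `x/|x|` of the unit sphere, for `x ≠ 0`. -/
def sphMap (n : ℕ) (x : EuclideanSpace ℝ (Fin n)) (hx : x ≠ 0) :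
    Metric.sphere (0 : EuclideanSpace ℝ (Fin n)) 1 :=
  ⟨‖x‖⁻¹ • x, by
    rw [mem_sphere_zero_iff_norm, norm_smul, norm_inv, norm_norm,
      inv_mul_cancel₀ (norm_ne_zero_iff.mpr hx)]⟩

section WLsec
open scoped RealInnerProductSpace
set_option linter.unusedSectionVars false
namespace WL

section planch
variable {E : Type*} [NormedAddCommGroup E] [InnerProductSpace ℝ E] [FiniteDimensional ℝ E]
  [MeasurableSpace E] [BorelSpace E]

lemma planch (f : E → ℂ) (hf : Integrable f) (h2 : MemLp f 2 volume) :
    eLpNorm (𝓕 f) 2 volume = eLpNorm f 2 volume := by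
  have hcont : Continuous (𝓕 f) :=
    VectorFourier.fourierIntegral_continuous Real.continuous_fourierChar
      (by simpa using! continuous_inner) hf
  have key : ∀ᵐ x, (𝓕 (h2.toLp f) : Lp ℂ 2 (volume : Measure E)) x = 𝓕 f x := by
    apply ae_eq_of_integral_contDiff_smul_eq
    · exact (Lp.memLp (𝓕 (h2.toLp f) : Lp ℂ 2 (volume : Measure E))).locallyIntegrable (by norm_num)
    · exact hcont.locallyIntegrable
    · intro g hg hgc
      have hgc' : HasCompactSupport (fun x => (g x : ℂ)) := hgc.comp_left (g := Complex.ofReal) (by simp)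
      let G : 𝓢(E, ℂ) := hgc'.toSchwartzMap (Complex.ofRealCLM.contDiff.comp hg)
      have hG : ∀ x, G x = (g x : ℂ) := fun x => rfl
      have h1 := congrArg (fun T => T G) (Lp.fourier_toTemperedDistribution_eq (h2.toLp f))
      simp only [TemperedDistribution.fourier_apply, Lp.toTemperedDistribution_apply] at h1
      have h3 : ∫ x, (𝓕 G) x • (h2.toLp f) x = ∫ x, (𝓕 G) x • f x := by
        apply integral_congr_ae
        filter_upwards [h2.coeFn_toLp] with x hx
        rw [hx]
      have h4 : ∫ x, (𝓕 (G : E → ℂ)) x • f x = ∫ x, G x • (𝓕 f) x := by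
        simpa using! (VectorFourier.integral_fourierIntegral_smul_eq_flip (L := innerₗ E)
          (μ := volume) (ν := volume) (f := (G : E → ℂ)) (g := f)
          Real.continuous_fourierChar continuous_inner G.integrable hf)
      rw [h3, SchwartzMap.fourier_coe, h4] at h1
      simp only [hG] at h1
      simpa [Complex.real_smul] using h1.symm
  rw [← eLpNorm_congr_ae key]
  have := Lp.norm_fourier_eq (h2.toLp f)
  rw [Lp.norm_def, Lp.norm_def, eLpNorm_congr_ae h2.coeFn_toLp] at this
  exact (ENNReal.toReal_eq_toReal_iff' (Lp.eLpNorm_ne_top _) h2.2.ne).1 this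

lemma planch_inv (f : E → ℂ) (hf : Integrable f) (h2 : MemLp f 2 volume) :
    eLpNorm (𝓕⁻ f) 2 volume = eLpNorm f 2 volume := by
  rw [← planch f hf h2]
  have : 𝓕⁻ f = 𝓕 f ∘ (fun x => -x) := by
    ext x; simp [Real.fourierInv_eq_fourier_neg]
  rw [this]
  have hcont : Continuous (𝓕 f) :=
    VectorFourier.fourierIntegral_continuous Real.continuous_fourierChar
      (by simpa using! continuous_inner) hf
  exact eLpNorm_comp_measurePreserving hcont.aestronglyMeasurable (Measure.measurePreserving_neg volume)

lemma lint_eq_eLp (f : E → ℂ) : ∫⁻ x, ‖f x‖ₑ ^ 2 = eLpNorm f 2 volume ^ 2 := by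
  have := eLpNorm_nnreal_pow_eq_lintegral (μ := (volume : Measure E)) (f := f) (p := 2) (by norm_num)
  simpa using this.symm

lemma planch_lint (f : E → ℂ) (hf : Integrable f) (h2 : MemLp f 2 volume) :
    ∫⁻ x, ‖𝓕 f x‖ₑ ^ 2 = ∫⁻ x, ‖f x‖ₑ ^ 2 := by
  rw [lint_eq_eLp, lint_eq_eLp, planch f hf h2]

end planch

section polar
variable {E : Type*} [NormedAddCommGroup E] [NormedSpace ℝ E] [FiniteDimensional ℝ E]
  [MeasurableSpace E] [BorelSpace E] [Nontrivial E]

lemma polar_measure (μ : Measure E) [μ.IsAddHaarMeasure] :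
    Measure.map (fun q : sphere (0:E) 1 × ℝ => q.2 • (q.1 : E))
      ((μ.toSphere.prod (volume.restrict (Set.Ioi 0))).withDensity
        (fun q => ENNReal.ofReal (q.2 ^ (Module.finrank ℝ E - 1)))) = μ := by
  refine Measure.ext_of_lintegral _ fun f hf => ?_
  rw [lintegral_map hf (by fun_prop), lintegral_withDensity_eq_lintegral_mul _ (by fun_prop) (by fun_prop)]
  have h1 : ∫⁻ x, f x ∂μ = ∫⁻ x : ({(0)}ᶜ : Set E), f x.1 ∂(μ.comap (↑)) := by
    rw [lintegral_subtype_comap (measurableSet_singleton _).compl,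
        restrict_compl_singleton]
  have h2 := μ.measurePreserving_homeomorphUnitSphereProd.lintegral_comp_emb
        (Homeomorph.measurableEmbedding _) (fun q => f (q.2.1 • (q.1 : E)))
  have h3 : ∀ x : ({(0)}ᶜ : Set E), ((homeomorphUnitSphereProd E x).2.1 • ((homeomorphUnitSphereProd E x).1 : E)) = x.1 := by
    intro x
    have hx : ‖x.1‖ ≠ 0 := norm_ne_zero_iff.2 x.2
    simp [smul_smul, mul_inv_cancel₀ hx]
  simp only [h3] at h2
  rw [h1, h2, lintegral_prod _ (by fun_prop), lintegral_prod _ (by fun_prop)]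
  congr 1
  ext ω
  rw [Measure.volumeIoiPow, lintegral_withDensity_eq_lintegral_mul _ (by fun_prop) (by fun_prop),
    ← lintegral_subtype_comap measurableSet_Ioi]
  rfl

lemma polar_lint (μ : Measure E) [μ.IsAddHaarMeasure] (f : E → ℝ≥0∞) (hf : Measurable f) :
    ∫⁻ x, f x ∂μ = ∫⁻ ρ in Set.Ioi (0:ℝ), ENNReal.ofReal (ρ ^ (Module.finrank ℝ E - 1)) *
      ∫⁻ ω, f (ρ • (ω : E)) ∂μ.toSphere := by
  conv_lhs => rw [← polar_measure μ]
  rw [lintegral_map hf (by fun_prop), lintegral_withDensity_eq_lintegral_mul _ (by fun_prop) (by fun_prop),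
    lintegral_prod_symm _ (by fun_prop)]
  congr 1
  ext ρ
  simp only [Pi.mul_apply]
  rw [lintegral_const_mul _ (by fun_prop)]

lemma polar_integrable (μ : Measure E) [μ.IsAddHaarMeasure] (f : E → ℂ) (hf : Integrable f μ)
    (hm : Measurable f) :
    Integrable (fun q : sphere (0:E) 1 × ℝ => ((q.2 ^ (Module.finrank ℝ E - 1) : ℝ) : ℂ) * f (q.2 • (q.1 : E)))
      (μ.toSphere.prod (volume.restrict (Set.Ioi 0))) := by
  have h := hf
  rw [← polar_measure μ, integrable_map_measure (by fun_prop) (by fun_prop)] at h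
  rw [integrable_withDensity_iff_integrable_smul' (by fun_prop) (by simp)] at h
  refine h.congr ?_
  have : ∀ᵐ q : sphere (0:E) 1 × ℝ ∂(μ.toSphere.prod (volume.restrict (Set.Ioi 0))), 0 < q.2 := by
    have := Measure.quasiMeasurePreserving_snd (μ := μ.toSphere) (ν := (volume.restrict (Set.Ioi (0:ℝ))))
    exact this.ae (ae_restrict_mem measurableSet_Ioi)
  filter_upwards [this] with q hq
  rw [ENNReal.toReal_ofReal (by positivity)]
  simp

lemma polar_int (μ : Measure E) [μ.IsAddHaarMeasure] (f : E → ℂ) (hf : Integrable f μ)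
    (hm : Measurable f) :
    ∫ x, f x ∂μ = ∫ q : sphere (0:E) 1 × ℝ, ((q.2 ^ (Module.finrank ℝ E - 1) : ℝ) : ℂ) * f (q.2 • (q.1 : E))
      ∂(μ.toSphere.prod (volume.restrict (Set.Ioi 0))) := by
  conv_lhs => rw [← polar_measure μ]
  rw [integral_map (by fun_prop) (by fun_prop), integral_withDensity_eq_integral_toReal_smul (by fun_prop) (by simp)]
  apply integral_congr_ae
  have : ∀ᵐ q : sphere (0:E) 1 × ℝ ∂(μ.toSphere.prod (volume.restrict (Set.Ioi 0))), 0 < q.2 := by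
    have := Measure.quasiMeasurePreserving_snd (μ := μ.toSphere) (ν := (volume.restrict (Set.Ioi (0:ℝ))))
    exact this.ae (ae_restrict_mem measurableSet_Ioi)
  filter_upwards [this] with q hq
  rw [ENNReal.toReal_ofReal (by positivity)]
  simp

end polar
end WL

namespace WL

section sphere
variable {E : Type*} [NormedAddCommGroup E] [InnerProductSpace ℝ E] [FiniteDimensional ℝ E]
  [MeasurableSpace E] [BorelSpace E] [Nontrivial E]

lemma bump_radial (d : ℕ) (hd : 2 ≤ d) : ∃ b : ℝ → ℝ, ContDiff ℝ 1 b ∧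
    (∀ x, b x ≠ 0 → 1 < x ∧ x < 3) ∧
    ∃ B : ℝ, 0 < B ∧ (∫ ρ in Set.Ioi (0:ℝ), ρ ^ (d-2) * b ρ = B) ∧
      (∫ ρ in Set.Ioi (0:ℝ), ρ ^ (d-1) * deriv b ρ = -((d:ℝ)-1) * B) ∧
      IntegrableOn (fun ρ => ρ ^ (d-2) * b ρ) (Set.Ioi 0) ∧
      IntegrableOn (fun ρ => ρ ^ (d-1) * deriv b ρ) (Set.Ioi 0) := by
  let b0 : ContDiffBump (2:ℝ) := ⟨1/2, 1, by norm_num, by norm_num⟩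
  have hb : ContDiff ℝ 1 (b0 : ℝ → ℝ) := b0.contDiff
  have hcs : HasCompactSupport (b0 : ℝ → ℝ) := b0.hasCompactSupport
  have hsupp : ∀ x, b0 x ≠ 0 → 1 < x ∧ x < 3 := by
    intro x hx
    have : x ∈ Function.support b0 := hx
    rw [b0.support_eq, Metric.mem_ball, Real.dist_eq, abs_lt] at this
    have h1 : b0.rOut = 1 := rfl
    rw [h1] at this
    constructor <;> linarith [this.1, this.2]
  have hdb : Continuous (deriv b0) := hb.continuous_deriv le_rfl
  have hcs' : HasCompactSupport (deriv b0) := hcs.deriv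
  have hsuppd : ∀ x ≤ 0, deriv b0 x = 0 := by
    intro x hx
    have : (b0 : ℝ → ℝ) =ᶠ[nhds x] fun _ => 0 := by
      filter_upwards [Iio_mem_nhds (show x < 1 by linarith)] with y hy
      by_contra h
      exact absurd (hsupp y h).1 (by simpa using hy.le)
    rw [this.deriv_eq]; simp
  have hc1 : Continuous (fun ρ : ℝ => ρ ^ (d-2) * b0 ρ) := by
    have := hb.continuous; fun_prop
  have hi1 : Integrable (fun ρ : ℝ => ρ ^ (d-2) * b0 ρ) :=
    hc1.integrable_of_hasCompactSupport hcs.mul_left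
  have hc2 : Continuous (fun ρ : ℝ => ρ ^ (d-1) * deriv b0 ρ) := by fun_prop
  have hi2 : Integrable (fun ρ : ℝ => ρ ^ (d-1) * deriv b0 ρ) :=
    hc2.integrable_of_hasCompactSupport hcs'.mul_left
  have e1 : ∫ ρ in Set.Ioi (0:ℝ), ρ ^ (d-2) * b0 ρ = ∫ ρ, ρ ^ (d-2) * b0 ρ := by
    apply setIntegral_eq_integral_of_forall_compl_eq_zero
    intro x hx
    have : b0 x = 0 := by
      by_contra h
      have := (hsupp x h).1
      simp at hx; linarith
    simp [this]
  have e2 : ∫ ρ in Set.Ioi (0:ℝ), ρ ^ (d-1) * deriv b0 ρ = ∫ ρ, ρ ^ (d-1) * deriv b0 ρ := by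
    apply setIntegral_eq_integral_of_forall_compl_eq_zero
    intro x hx
    rw [hsuppd x (by simpa using hx)]; simp
  refine ⟨b0, hb, hsupp, ∫ ρ, ρ ^ (d-2) * b0 ρ, ?_, e1, ?_, hi1.integrableOn, hi2.integrableOn⟩
  · apply hc1.integral_pos_of_hasCompactSupport_nonneg_nonzero hcs.mul_left
    · intro x
      by_cases h : b0 x = 0
      · simp [h]
      · have := (hsupp x h).1
        have h0 := b0.nonneg (x := x)
        show 0 ≤ x ^ (d-2) * b0 x
        positivity
    · show (2:ℝ)^(d-2) * b0 2 ≠ 0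
      have : b0 2 = 1 := b0.one_of_mem_closedBall (by simpa using b0.rIn_pos.le)
      rw [this]; positivity
  · rw [e2, integral_mul_deriv_eq_deriv_mul_of_integrable (u := fun ρ : ℝ => ρ ^ (d-1)) (v := b0)
      (u' := fun ρ => ((d-1:ℕ):ℝ) * ρ ^ (d-2)) (v' := deriv b0)]
    · rw [← integral_const_mul, ← integral_neg]
      congr 1; ext ρ
      rw [Nat.cast_sub (by omega)]; push_cast; ring
    · intro x _
      have := hasDerivAt_pow (d-1) x
      simpa [Nat.sub_sub] using this
    · intro x _
      exact (hb.differentiable (by norm_num) x).hasDerivAt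
    · exact hi2
    · refine (hi1.const_mul ((d-1:ℕ):ℝ)).congr (Filter.Eventually.of_forall fun x => ?_)
      simp [mul_assoc]
    · have : Continuous (fun ρ : ℝ => ρ ^ (d-1) * b0 ρ) := by
        have := hb.continuous; fun_prop
      exact this.integrable_of_hasCompactSupport hcs.mul_left

/-- divergence identity on the sphere -/
lemma div_id (hd : 2 ≤ Module.finrank ℝ E) (e : E) (he : ‖e‖ = 1) (g : ℝ → ℂ) (hg : ContDiff ℝ 1 g) :
    ∫ ω : sphere (0:E) 1, (1 - (⟪(ω:E), e⟫ : ℂ) ^ 2) * deriv g ⟪(ω:E), e⟫ ∂(volume : Measure E).toSphere =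
    ((Module.finrank ℝ E : ℂ) - 1) *
      ∫ ω : sphere (0:E) 1, (⟪(ω:E), e⟫ : ℂ) * g ⟪(ω:E), e⟫ ∂(volume : Measure E).toSphere := by
  set d := Module.finrank ℝ E with hdd
  obtain ⟨b, hb, hbs, B, hB, hB1, hB2, hi1, hi2⟩ := bump_radial d hd
  set Φ : E → ℂ := fun x => (b ‖x‖ : ℂ) * g (⟪x, e⟫ / ‖x‖) with hΦ
  have hb0 : ∀ x, x ≤ 1 → b x = 0 := fun x hx => by
    by_contra h; linarith [(hbs x h).1]
  have hΦc : ContDiff ℝ 1 Φ := by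
    rw [contDiff_iff_contDiffAt]
    intro x
    by_cases hx : x = 0
    · have : Φ =ᶠ[nhds x] fun _ => 0 := by
        filter_upwards [Metric.ball_mem_nhds x one_pos] with y hy
        have : ‖y‖ < 1 := by simpa [hx] using hy
        simp [hΦ, hb0 _ this.le]
      exact contDiffAt_const.congr_of_eventuallyEq this
    · have hn : ContDiffAt ℝ 1 (fun x : E => ‖x‖) x := contDiffAt_norm ℝ hx
      have h1 : ContDiffAt ℝ 1 (fun x : E => b ‖x‖) x := hb.contDiffAt.comp x hn
      have h2 : ContDiffAt ℝ 1 (fun x : E => ⟪x, e⟫ / ‖x‖) x :=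
        (contDiffAt_id.inner ℝ contDiffAt_const).div hn (norm_ne_zero_iff.2 hx)
      have h3 : ContDiffAt ℝ 1 (fun x : E => g (⟪x, e⟫ / ‖x‖)) x := hg.contDiffAt.comp x h2
      exact ((Complex.ofRealCLM.contDiff.contDiffAt.comp x h1)).mul h3
  have hΦs : HasCompactSupport Φ := by
    apply HasCompactSupport.intro (isCompact_closedBall (0:E) 3)
    intro x hx
    have : b ‖x‖ = 0 := by
      by_contra h
      have := (hbs _ h).2
      simp at hx; linarith
    simp [hΦ, this]
  have hDc : Continuous (fun x => fderiv ℝ Φ x e) := (hΦc.continuous_fderiv (by norm_num)).clm_apply continuous_const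
  have hDs : HasCompactSupport (fun x => fderiv ℝ Φ x e) := hΦs.fderiv_apply ℝ e
  have hDi : Integrable (fun x => fderiv ℝ Φ x e) := hDc.integrable_of_hasCompactSupport hDs
  have hzero : ∫ x, fderiv ℝ Φ x e = 0 := by
    have := integral_mul_fderiv_eq_neg_fderiv_mul_of_integrable (μ := (volume : Measure E)) (𝕜 := ℂ)
      (f := fun _ => (1:ℂ)) (g := Φ) (v := e) (by simp) (by simpa using hDi)
      (by simpa using hΦc.continuous.integrable_of_hasCompactSupport hΦs) (by intros; fun_prop)
      (fun x _ => hΦc.differentiable (by norm_num) x)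
    simpa using this
  have hform : ∀ (ω : sphere (0:E) 1) (ρ : ℝ), 0 < ρ → fderiv ℝ Φ (ρ • (ω:E)) e =
      ((deriv b ρ : ℝ) : ℂ) * (⟪(ω:E), e⟫ * g ⟪(ω:E), e⟫) + ((b ρ / ρ : ℝ) : ℂ) * ((1 - (⟪(ω:E), e⟫ : ℂ) ^ 2) * deriv g ⟪(ω:E), e⟫) := by
    intro ω ρ hρ
    have hω : ‖(ω:E)‖ = 1 := by simp
    have hx0 : ρ • (ω:E) ≠ 0 := smul_ne_zero hρ.ne' (by rw [← norm_ne_zero_iff, hω]; norm_num)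
    have hnx : ‖ρ • (ω:E)‖ = ρ := by rw [norm_smul, hω, Real.norm_of_nonneg hρ.le, mul_one]
    set s : ℝ := ⟪(ω:E), e⟫ with hs
    have hl : HasDerivAt (fun t : ℝ => ρ • (ω:E) + t • e) e 0 := by
      simpa using ((hasDerivAt_id (0:ℝ)).smul_const e).const_add (ρ • (ω:E))
    have h1 : HasDerivAt (fun t : ℝ => Φ (ρ • (ω:E) + t • e)) (fderiv ℝ Φ (ρ • (ω:E)) e) 0 := by
      have : HasFDerivAt Φ (fderiv ℝ Φ (ρ • (ω:E))) (ρ • (ω:E) + (0:ℝ) • e) := by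
        simpa using (hΦc.differentiable (by norm_num) (ρ • (ω:E))).hasFDerivAt
      exact this.comp_hasDerivAt (0:ℝ) hl
    have hN : HasDerivAt (fun t : ℝ => ‖ρ • (ω:E) + t • e‖) s 0 := by
      have h := hl.norm_sq.sqrt (by simpa using hx0)
      have hee : (fun t : ℝ => ‖ρ • (ω:E) + t • e‖) = fun t : ℝ => √(‖ρ • (ω:E) + t • e‖^2) := by
        ext t; rw [Real.sqrt_sq (norm_nonneg _)]
      rw [hee]
      convert h using 1
      simp only [zero_smul, add_zero, hnx, Real.sqrt_sq hρ.le, inner_smul_left]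
      simp; field_simp; rfl
    have hI : HasDerivAt (fun t : ℝ => ⟪ρ • (ω:E) + t • e, e⟫) 1 0 := by
      have := hl.inner ℝ (hasDerivAt_const (0:ℝ) e)
      simpa [real_inner_self_eq_norm_sq, he] using this
    have hQ : HasDerivAt (fun t : ℝ => ⟪ρ • (ω:E) + t • e, e⟫ / ‖ρ • (ω:E) + t • e‖) ((1 - s^2)/ρ) 0 := by
      have := hI.div hN (by simpa using hx0)
      have w0 : ‖ρ • (ω:E) + (0:ℝ) • e‖ = ρ := by simp only [zero_smul, add_zero, hnx]
      have w1 : ⟪ρ • (ω:E) + (0:ℝ) • e, e⟫ = ρ * s := by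
        simp only [zero_smul, add_zero, inner_smul_left]; simp; left; rfl
      refine this.congr_deriv ?_
      rw [w0, w1]
      field_simp
    have v0 : ‖ρ • (ω:E) + (0:ℝ) • e‖ = ρ := by simp only [zero_smul, add_zero, hnx]
    have v1 : ⟪ρ • (ω:E) + (0:ℝ) • e, e⟫ / ‖ρ • (ω:E) + (0:ℝ) • e‖ = s := by
      rw [v0]; simp only [zero_smul, add_zero, inner_smul_left]; simp; field_simp; rfl
    have hbd : HasDerivAt (fun t : ℝ => b ‖ρ • (ω:E) + t • e‖) (deriv b ρ * s) 0 := by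
      have h0 : HasDerivAt b (deriv b ρ) ‖ρ • (ω:E) + (0:ℝ) • e‖ := by
        rw [v0]; exact (hb.differentiable (by norm_num) ρ).hasDerivAt
      exact h0.comp (0:ℝ) hN
    have hgd : HasDerivAt (fun t : ℝ => g (⟪ρ • (ω:E) + t • e, e⟫ / ‖ρ • (ω:E) + t • e‖)) (((1 - s^2)/ρ) • deriv g s) 0 := by
      have h0 : HasDerivAt g (deriv g s) (⟪ρ • (ω:E) + (0:ℝ) • e, e⟫ / ‖ρ • (ω:E) + (0:ℝ) • e‖) := by
        rw [v1]; exact (hg.differentiable (by norm_num) s).hasDerivAt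
      exact h0.scomp (0:ℝ) hQ
    have h2 := hbd.ofReal_comp.mul hgd
    have h3 := h1.unique h2
    rw [h3, v1, v0]
    simp only [Complex.real_smul]
    push_cast
    ring
  rw [polar_int volume _ hDi hDc.measurable] at hzero
  have hcongr : ∀ᵐ q : sphere (0:E) 1 × ℝ ∂((volume : Measure E).toSphere.prod (volume.restrict (Set.Ioi 0))),
      ((q.2 ^ (Module.finrank ℝ E - 1) : ℝ) : ℂ) * fderiv ℝ Φ (q.2 • (q.1 : E)) e =
      ((⟪(q.1:E), e⟫:ℂ) * g ⟪(q.1:E), e⟫) * ((q.2 ^ (d-1) * deriv b q.2 : ℝ):ℂ) +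
      ((1 - (⟪(q.1:E), e⟫ : ℂ) ^ 2) * deriv g ⟪(q.1:E), e⟫) * ((q.2 ^ (d-2) * b q.2 : ℝ):ℂ) := by
    have := Measure.quasiMeasurePreserving_snd (μ := (volume : Measure E).toSphere) (ν := (volume.restrict (Set.Ioi (0:ℝ))))
    filter_upwards [this.ae (ae_restrict_mem measurableSet_Ioi)] with q hq
    have hq : 0 < q.2 := hq
    rw [hform q.1 q.2 hq]
    have : q.2 ^ (d-1) = q.2 ^ (d-2) * q.2 := by
      rw [← pow_succ]; congr 1; omega
    rw [← hdd, this]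
    push_cast
    have : (q.2:ℂ) ≠ 0 := by exact_mod_cast hq.ne'
    field_simp
  rw [integral_congr_ae hcongr] at hzero
  have hgc := hg.continuous
  have hgd : Continuous (deriv g) := hg.continuous_deriv le_rfl
  have hc1 : Continuous (fun ω : sphere (0:E) 1 => (⟪(ω:E), e⟫:ℂ) * g ⟪(ω:E), e⟫) := by fun_prop
  have hc2 : Continuous (fun ω : sphere (0:E) 1 => (1 - (⟪(ω:E), e⟫ : ℂ) ^ 2) * deriv g ⟪(ω:E), e⟫) := by fun_prop
  have hs1 : Integrable (fun ω : sphere (0:E) 1 => (⟪(ω:E), e⟫:ℂ) * g ⟪(ω:E), e⟫) (volume : Measure E).toSphere :=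
    hc1.integrable_of_hasCompactSupport (HasCompactSupport.of_compactSpace _)
  have hs2 : Integrable (fun ω : sphere (0:E) 1 => (1 - (⟪(ω:E), e⟫ : ℂ) ^ 2) * deriv g ⟪(ω:E), e⟫) (volume : Measure E).toSphere :=
    hc2.integrable_of_hasCompactSupport (HasCompactSupport.of_compactSpace _)
  have hi1c : Integrable (fun ρ : ℝ => ((ρ ^ (d-2) * b ρ : ℝ):ℂ)) (volume.restrict (Set.Ioi 0)) := hi1.ofReal
  have hi2c : Integrable (fun ρ : ℝ => ((ρ ^ (d-1) * deriv b ρ : ℝ):ℂ)) (volume.restrict (Set.Ioi 0)) := hi2.ofReal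
  rw [integral_add (hs1.mul_prod hi2c) (hs2.mul_prod hi1c),
    integral_prod_mul (fun ω : sphere (0:E) 1 => (⟪(ω:E), e⟫:ℂ) * g ⟪(ω:E), e⟫) (fun ρ : ℝ => ((ρ ^ (d-1) * deriv b ρ : ℝ):ℂ)),
    integral_prod_mul (fun ω : sphere (0:E) 1 => (1 - (⟪(ω:E), e⟫ : ℂ) ^ 2) * deriv g ⟪(ω:E), e⟫) (fun ρ : ℝ => ((ρ ^ (d-2) * b ρ : ℝ):ℂ)),
    integral_complex_ofReal, integral_complex_ofReal] at hzero
  rw [hB1, hB2] at hzero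
  have hBc : (B:ℂ) ≠ 0 := by exact_mod_cast hB.ne'
  apply mul_right_cancel₀ hBc
  push_cast at hzero
  linear_combination hzero
end sphere
end WL

namespace WL

lemma energy (v v1 : ℝ → ℂ) (c : ℝ) (h1 : ∀ r, 0 < r → HasDerivAt v (v1 r) r)
    (h2 : ∀ r, 0 < r → HasDerivAt v1 (-(v r) + ((c / r^2 : ℝ) : ℂ) * v r) r) (r : ℝ) (hr : 1 ≤ r) :
    ‖v r‖^2 + ‖v1 r‖^2 ≤ Real.exp |c| * (‖v 1‖^2 + ‖v1 1‖^2) := by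
  set G : ℝ → ℝ := fun r => (‖v r‖^2 + ‖v1 r‖^2) * Real.exp (|c| * r⁻¹) with hG
  have hd : ∀ r, 0 < r → HasDerivAt G ((2 * ⟪v r, v1 r⟫ + 2 * ⟪v1 r, -(v r) + ((c / r^2 : ℝ) : ℂ) * v r⟫) *
      Real.exp (|c| * r⁻¹) + (‖v r‖^2 + ‖v1 r‖^2) * (Real.exp (|c| * r⁻¹) * (|c| * (-(r^2)⁻¹)))) r := by
    intro r hr
    have ha := ((h1 r hr).norm_sq).add ((h2 r hr).norm_sq)
    have hb := ((hasDerivAt_inv hr.ne').const_mul |c|).exp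
    exact ha.mul hb
  have hanti : AntitoneOn G (Set.Ici 1) := by
    apply antitoneOn_of_deriv_nonpos (convex_Ici 1)
    · intro x hx
      exact (hd x (lt_of_lt_of_le one_pos hx)).continuousAt.continuousWithinAt
    · intro x hx
      rw [interior_Ici] at hx
      exact (hd x (one_pos.trans hx)).differentiableAt.differentiableWithinAt
    · intro x hx
      rw [interior_Ici] at hx
      have hx0 : 0 < x := one_pos.trans hx
      rw [(hd x hx0).deriv]
      have e1 : ⟪v1 x, -(v x) + ((c / x^2 : ℝ) : ℂ) * v x⟫ = - ⟪v x, v1 x⟫ + (c/x^2) * ⟪v x, v1 x⟫ := by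
        rw [inner_add_right, inner_neg_right, ← Complex.real_smul, inner_smul_right, real_inner_comm]
      rw [e1]
      have hcs : c * (2 * ⟪v x, v1 x⟫) ≤ |c| * (‖v x‖^2 + ‖v1 x‖^2) := by
        have h := abs_real_inner_le_norm (v x) (v1 x)
        calc c * (2 * ⟪v x, v1 x⟫) ≤ |c * (2 * ⟪v x, v1 x⟫)| := le_abs_self _
          _ = |c| * (2 * |⟪v x, v1 x⟫|) := by rw [abs_mul, abs_mul]; simp
          _ ≤ _ := by
            gcongr
            nlinarith [sq_nonneg (‖v x‖ - ‖v1 x‖)]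
      have : (2 * ⟪v x, v1 x⟫ + 2 * (-⟪v x, v1 x⟫ + c / x ^ 2 * ⟪v x, v1 x⟫)) * Real.exp (|c| * x⁻¹) +
        (‖v x‖ ^ 2 + ‖v1 x‖ ^ 2) * (Real.exp (|c| * x⁻¹) * (|c| * -(x ^ 2)⁻¹)) =
        Real.exp (|c| * x⁻¹) * (x^2)⁻¹ * (c * (2 * ⟪v x, v1 x⟫) - |c| * (‖v x‖^2 + ‖v1 x‖^2)) := by
        field_simp; ring
      rw [this]
      apply mul_nonpos_of_nonneg_of_nonpos (by positivity) (by linarith)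
  have h := hanti (Set.mem_Ici.2 le_rfl) (Set.mem_Ici.2 hr) hr
  have hr0 : 0 < r := by linarith
  calc ‖v r‖^2 + ‖v1 r‖^2 ≤ G r := by
        apply le_mul_of_one_le_right (by positivity)
        apply Real.one_le_exp; positivity
    _ ≤ G 1 := h
    _ = _ := by simp [hG]; ring

section sphere
variable {E : Type*} [NormedAddCommGroup E] [InnerProductSpace ℝ E] [FiniteDimensional ℝ E]
  [MeasurableSpace E] [BorelSpace E] [Nontrivial E]

def mom (e : E) (k : ℕ) (r : ℝ) : ℂ :=
  ∫ ω : sphere (0:E) 1, (⟪(ω:E), e⟫ : ℂ)^k * cexp (I * r * ⟪(ω:E), e⟫) ∂(volume : Measure E).toSphere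

lemma sph_int (f : sphere (0:E) 1 → ℂ) (hf : Continuous f) : Integrable f (volume : Measure E).toSphere :=
  hf.integrable_of_hasCompactSupport (HasCompactSupport.of_compactSpace _)

lemma norm_integrand (e : E) (he : ‖e‖ = 1) (k : ℕ) (r : ℝ) (ω : sphere (0:E) 1) :
    ‖(⟪(ω:E), e⟫ : ℂ)^k * cexp (I * r * ⟪(ω:E), e⟫)‖ ≤ 1 := by
  have hs : |⟪(ω:E), e⟫| ≤ 1 := by
    have := abs_real_inner_le_norm (ω:E) e
    simpa [he] using this
  have h2 : ‖cexp (I * r * ⟪(ω:E), e⟫)‖ = 1 := by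
    have : I * r * (⟪(ω:E), e⟫:ℂ) = ((r * ⟪(ω:E), e⟫ : ℝ):ℂ) * I := by push_cast; ring
    rw [this, Complex.norm_exp_ofReal_mul_I]
  rw [norm_mul, norm_pow, h2, mul_one, Complex.norm_real, Real.norm_eq_abs]
  exact pow_le_one₀ (abs_nonneg _) hs

lemma mom_bound (e : E) (he : ‖e‖ = 1) (k : ℕ) (r : ℝ) :
    ‖mom e k r‖ ≤ (volume : Measure E).toSphere.real Set.univ := by
  have := norm_integral_le_of_norm_le_const (μ := (volume : Measure E).toSphere)
    (Filter.Eventually.of_forall (norm_integrand e he k r))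
  simpa [mom] using this

lemma mom_deriv (e : E) (he : ‖e‖ = 1) (k : ℕ) (r : ℝ) :
    HasDerivAt (mom e k) (I * mom e (k+1) r) r := by
  have h := hasDerivAt_integral_of_dominated_loc_of_deriv_le (μ := (volume : Measure E).toSphere)
    (F := fun (r:ℝ) (ω : sphere (0:E) 1) => (⟪(ω:E), e⟫ : ℂ)^k * cexp (I * r * ⟪(ω:E), e⟫))
    (F' := fun (r:ℝ) (ω : sphere (0:E) 1) => I * ((⟪(ω:E), e⟫ : ℂ)^(k+1) * cexp (I * r * ⟪(ω:E), e⟫)))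
    (x₀ := r) (s := Set.univ) (bound := fun _ => 1) Filter.univ_mem
    (Filter.Eventually.of_forall fun r => (sph_int _ (by fun_prop)).aestronglyMeasurable)
    (sph_int _ (by fun_prop)) (sph_int _ (by fun_prop)).aestronglyMeasurable
    (Filter.Eventually.of_forall fun ω x _ => by
      rw [norm_mul, Complex.norm_I, one_mul]; exact norm_integrand e he _ _ _)
    (integrable_const _)
    (Filter.Eventually.of_forall fun ω x _ => by
      have h0 : HasDerivAt (fun x : ℝ => (I * x * ⟪(ω:E), e⟫ : ℂ)) (I * 1 * ⟪(ω:E), e⟫) x :=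
        ((Complex.ofRealCLM.hasDerivAt (x := x)).const_mul I).mul_const _
      refine ((h0.cexp).const_mul ((⟪(ω:E), e⟫ : ℂ)^k)).congr_deriv ?_
      ring)
  have h2 := h.2
  rw [integral_const_mul] at h2
  exact h2

lemma mom_rel (hd : 2 ≤ Module.finrank ℝ E) (e : E) (he : ‖e‖ = 1) (r : ℝ) :
    I * r * (mom e 0 r - mom e 2 r) = ((Module.finrank ℝ E : ℂ) - 1) * mom e 1 r := by
  have h := div_id hd e he (fun s : ℝ => cexp (I * r * s)) (by
    have : ContDiff ℝ 1 (fun s : ℝ => (s:ℂ)) := Complex.ofRealCLM.contDiff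
    fun_prop)
  have hder : ∀ s : ℝ, deriv (fun s : ℝ => cexp (I * r * s)) s = I * r * cexp (I * r * s) := by
    intro s
    have h0 : HasDerivAt (fun x : ℝ => (I * r * x : ℂ)) (I * r * 1) s :=
      (Complex.ofRealCLM.hasDerivAt (x := s)).const_mul _
    rw [h0.cexp.deriv]; ring
  simp only [hder] at h
  have h1 : mom e 1 r = ∫ ω : sphere (0:E) 1, (⟪(ω:E), e⟫ : ℂ) * cexp (I * r * ⟪(ω:E), e⟫) ∂(volume : Measure E).toSphere := by
    simp [mom]
  rw [h1, ← h, mom, mom, ← integral_sub (sph_int _ (by fun_prop)) (sph_int _ (by fun_prop)), ← integral_const_mul]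
  congr 1; ext ω
  ring

lemma mom_decay (hd : 2 ≤ Module.finrank ℝ E) : ∃ C : ℝ, 0 < C ∧ ∀ e : E, ‖e‖ = 1 → ∀ r : ℝ, 1 ≤ r →
    ‖mom e 0 r‖ ≤ C * r ^ (-(((Module.finrank ℝ E : ℝ) - 1)/2)) := by
  set a : ℝ := ((Module.finrank ℝ E : ℝ) - 1)/2 with ha
  have ha0 : 0 ≤ a := by
    have : (2:ℝ) ≤ Module.finrank ℝ E := by exact_mod_cast hd
    rw [ha]; linarith
  set m := (volume : Measure E).toSphere.real Set.univ with hm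
  have hm0 : 0 ≤ m := measureReal_nonneg
  set c : ℝ := a^2 - a with hc
  set K : ℝ := Real.exp |c| * (m^2 + (m + a * m)^2) with hK
  have hK0 : 0 ≤ K := by positivity
  refine ⟨√K + 1, by positivity, ?_⟩
  intro e he r hr
  set v : ℝ → ℂ := fun r => ((r^a : ℝ):ℂ) * mom e 0 r with hv
  set v1 : ℝ → ℂ := fun r => ((r^a : ℝ):ℂ) * (I * mom e 1 r) + ((a * r^(a-1) : ℝ):ℂ) * mom e 0 r with hv1
  have h1 : ∀ r, 0 < r → HasDerivAt v (v1 r) r := by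
    intro r hr
    have h := (Real.hasDerivAt_rpow_const (x := r) (p := a) (Or.inl hr.ne')).ofReal_comp.mul (mom_deriv e he 0 r)
    refine h.congr_deriv ?_
    simp only [hv1]; ring
  have h2 : ∀ r, 0 < r → HasDerivAt v1 (-(v r) + ((c / r^2 : ℝ) : ℂ) * v r) r := by
    intro r hr
    have ha := (Real.hasDerivAt_rpow_const (x := r) (p := a) (Or.inl hr.ne')).ofReal_comp.mul ((mom_deriv e he 1 r).const_mul I)
    have hb := ((Real.hasDerivAt_rpow_const (x := r) (p := a-1) (Or.inl hr.ne')).const_mul a).ofReal_comp.mul (mom_deriv e he 0 r)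
    refine (ha.add hb).congr_deriv ?_
    have e1 : r^(a-1) = r^a / r := by rw [Real.rpow_sub hr, Real.rpow_one]
    have e2 : r^(a-1-1) = r^a / r^2 := by
      rw [Real.rpow_sub hr, e1, Real.rpow_one]; field_simp
    have hrel := mom_rel hd e he r
    have hda : (Module.finrank ℝ E : ℂ) - 1 = 2 * (a:ℂ) := by
      rw [‹a = _›]; push_cast; ring
    rw [hda] at hrel
    simp only [hv, e1, e2, hc]
    have hrc : (r:ℂ) ≠ 0 := by exact_mod_cast hr.ne'
    push_cast
    field_simp
    have hI : I^2 = -1 := Complex.I_sq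
    linear_combination ((r^a:ℝ):ℂ) * ((-I) * (r:ℂ) * hrel + (r:ℂ)^2 * (mom e 0 r) * hI)
  have hE := energy v v1 c h1 h2 r hr
  have hv1' : ‖v 1‖ ≤ m := by
    simp only [hv, Real.one_rpow, Complex.ofReal_one, one_mul]; exact mom_bound e he 0 1
  have hv2' : ‖v1 1‖ ≤ m + a * m := by
    simp only [hv1, Real.one_rpow]
    refine (norm_add_le _ _).trans ?_
    have q0 := mom_bound e he 0 1
    have q1 := mom_bound e he 1 1
    simp only [norm_mul, Complex.norm_I, Complex.norm_real, mul_one, one_mul, norm_one, Real.norm_eq_abs, abs_of_nonneg ha0]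
    gcongr
  have hr0 : 0 < r := by linarith
  have hvr : ‖v r‖ ≤ √K := by
    apply Real.le_sqrt_of_sq_le
    calc ‖v r‖^2 ≤ ‖v r‖^2 + ‖v1 r‖^2 := by nlinarith [sq_nonneg ‖v1 r‖]
      _ ≤ _ := hE
      _ ≤ K := by rw [hK]; gcongr
  have : ‖v r‖ = r^a * ‖mom e 0 r‖ := by
    simp only [hv, norm_mul, Complex.norm_real, Real.norm_eq_abs, abs_of_nonneg (Real.rpow_nonneg hr0.le a)]
  rw [this] at hvr
  rw [Real.rpow_neg hr0.le, ← div_eq_mul_inv, le_div_iff₀ (by positivity)]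
  linarith

/-- Fourier transform of surface measure -/
def sig (z : E) : ℂ := ∫ ω : sphere (0:E) 1, cexp (2 * Real.pi * ⟪z, (ω:E)⟫ * I) ∂(volume : Measure E).toSphere

lemma sig_bound (z : E) : ‖sig z‖ ≤ (volume : Measure E).toSphere.real Set.univ := by
  have := norm_integral_le_of_norm_le_const (μ := (volume : Measure E).toSphere) (C := 1)
    (f := fun ω : sphere (0:E) 1 => cexp (2 * Real.pi * ⟪z, (ω:E)⟫ * I))
    (Filter.Eventually.of_forall fun ω => by
      have : (2 * Real.pi * ⟪z, (ω:E)⟫ * I : ℂ) = ((2 * Real.pi * ⟪z, (ω:E)⟫ : ℝ):ℂ) * I := by push_cast; ring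
      rw [this, Complex.norm_exp_ofReal_mul_I])
  simpa [sig] using this

lemma sig_decay (hd : 2 ≤ Module.finrank ℝ E) : ∃ C : ℝ, 0 < C ∧ ∀ z : E, ‖sig z‖ ≤ C ∧ (1 ≤ ‖z‖ →
    ‖sig z‖ ≤ C * ‖z‖ ^ (-(((Module.finrank ℝ E : ℝ) - 1)/2))) := by
  obtain ⟨C, hC, h⟩ := mom_decay (E := E) hd
  refine ⟨C + (volume : Measure E).toSphere.real Set.univ, by positivity, fun z => ⟨?_, fun hz => ?_⟩⟩
  · linarith [sig_bound z]
  · have hz0 : 0 < ‖z‖ := by linarith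
    have he : ‖‖z‖⁻¹ • z‖ = 1 := by rw [norm_smul, norm_inv, norm_norm, inv_mul_cancel₀ hz0.ne']
    have hpi : 1 ≤ 2 * Real.pi := by linarith [Real.pi_gt_three]
    have h1 := h _ he (2 * Real.pi * ‖z‖) (by nlinarith)
    have e1 : mom (‖z‖⁻¹ • z) 0 (2 * Real.pi * ‖z‖) = sig z := by
      unfold mom sig
      congr 1; ext ω
      rw [pow_zero, one_mul]
      congr 1
      rw [inner_smul_right, real_inner_comm]
      push_cast
      have : (‖z‖:ℂ) ≠ 0 := by exact_mod_cast hz0.ne'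
      field_simp
    rw [e1] at h1
    refine h1.trans ?_
    have ha0 : 0 ≤ ((Module.finrank ℝ E : ℝ) - 1)/2 := by
      have : (2:ℝ) ≤ Module.finrank ℝ E := by exact_mod_cast hd
      linarith
    have : (2 * Real.pi * ‖z‖) ^ (-(((Module.finrank ℝ E : ℝ) - 1)/2)) ≤ ‖z‖ ^ (-(((Module.finrank ℝ E : ℝ) - 1)/2)) := by
      apply Real.rpow_le_rpow_of_nonpos hz0 (by nlinarith) (by linarith)
    calc _ ≤ C * ‖z‖ ^ (-(((Module.finrank ℝ E : ℝ) - 1)/2)) := by gcongr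
      _ ≤ _ := by
        gcongr
        linarith [measureReal_nonneg (μ := (volume : Measure E).toSphere) (s := Set.univ)]
end sphere
end WL

namespace WL

section sphere
variable {E : Type*} [NormedAddCommGroup E] [InnerProductSpace ℝ E] [FiniteDimensional ℝ E]
  [MeasurableSpace E] [BorelSpace E] [Nontrivial E]

lemma lint_smul (f : E → ℝ≥0∞) (hf : Measurable f) (R : ℝ) (hR : 0 < R) :
    ∫⁻ x, f (R • x) = ENNReal.ofReal ((R ^ Module.finrank ℝ E)⁻¹) * ∫⁻ x, f x := by
  have h := lintegral_map (μ := (volume : Measure E)) hf (measurable_const_smul R)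
  rw [← h]
  have h2 := Measure.map_addHaar_smul (volume : Measure E) hR.ne'
  rw [h2, lintegral_smul_measure]
  congr 2
  rw [abs_of_pos (by positivity)]

lemma thick : ∃ C : ℝ, 0 ≤ C ∧ ∀ R : ℝ, 0 < R → ∀ ζ : E,
    ENNReal.ofReal (R ^ Module.finrank ℝ E) *
    ∫⁻ ω : sphere (0:E) 1, ENNReal.ofReal ((1 + R * ‖ζ - (ω:E)‖) ^ (-((Module.finrank ℝ E : ℝ) + 1))) ∂(volume : Measure E).toSphere
      ≤ ENNReal.ofReal (C * R) := by
  set d := Module.finrank ℝ E with hd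
  set N : ℝ := (d:ℝ) + 1 with hN
  have hfin : ∫⁻ x : E, ENNReal.ofReal ((1 + ‖x‖) ^ (-N)) < ⊤ :=
    finite_integral_one_add_norm (by rw [hN, hd]; linarith)
  set J := ∫⁻ x : E, ENNReal.ofReal ((1 + ‖x‖) ^ (-N)) with hJ
  refine ⟨(2:ℝ)^N * J.toReal, by positivity, ?_⟩
  intro R hR ζ
  set A := ∫⁻ ω : sphere (0:E) 1, ENNReal.ofReal ((1 + R * ‖ζ - (ω:E)‖) ^ (-N)) ∂(volume : Measure E).toSphere with hA
  have key : ENNReal.ofReal R⁻¹ * A ≤ ENNReal.ofReal ((2:ℝ)^N) * (ENNReal.ofReal ((R ^ d)⁻¹) * J) := by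
    have hmeas : Measurable (fun x : E => ENNReal.ofReal ((1 + R * ‖ζ - x‖) ^ (-N))) := by fun_prop
    calc ENNReal.ofReal R⁻¹ * A = ∫⁻ s in Set.Icc (1:ℝ) (1 + R⁻¹), A := by
          rw [setLIntegral_const, Real.volume_Icc, mul_comm]; congr 2; ring
      _ ≤ ∫⁻ s in Set.Icc (1:ℝ) (1 + R⁻¹), ENNReal.ofReal ((2:ℝ)^N) * (ENNReal.ofReal (s ^ (d - 1)) *
            ∫⁻ ω : sphere (0:E) 1, ENNReal.ofReal ((1 + R * ‖ζ - s • (ω:E)‖) ^ (-N)) ∂(volume : Measure E).toSphere) := by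
          apply setLIntegral_mono' measurableSet_Icc
          intro s hs
          have h1 : (1:ℝ≥0∞) ≤ ENNReal.ofReal (s ^ (d-1)) := by
            rw [ENNReal.one_le_ofReal]; exact one_le_pow₀ hs.1
          calc A ≤ ∫⁻ ω : sphere (0:E) 1, ENNReal.ofReal ((2:ℝ)^N) * ENNReal.ofReal ((1 + R * ‖ζ - s • (ω:E)‖) ^ (-N)) ∂(volume : Measure E).toSphere := by
                apply lintegral_mono
                intro ω
                show ENNReal.ofReal _ ≤ ENNReal.ofReal _ * ENNReal.ofReal _
                rw [← ENNReal.ofReal_mul (by positivity)]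
                apply ENNReal.ofReal_le_ofReal
                have hdist : ‖ζ - s • (ω:E)‖ ≤ ‖ζ - (ω:E)‖ + R⁻¹ := by
                  have : ζ - s • (ω:E) = (ζ - (ω:E)) - (s - 1) • (ω:E) := by module
                  rw [this]
                  refine (norm_sub_le _ _).trans ?_
                  gcongr
                  rw [norm_smul]
                  have hω : ‖(ω:E)‖ = 1 := by simp
                  rw [hω, mul_one, Real.norm_eq_abs, abs_of_nonneg (by linarith [hs.1])]
                  linarith [hs.2]
                have h2 : (1 + R * ‖ζ - s • (ω:E)‖) / 2 ≤ 1 + R * ‖ζ - (ω:E)‖ := by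
                  have : R * ‖ζ - s • (ω:E)‖ ≤ R * (‖ζ - (ω:E)‖ + R⁻¹) := by gcongr
                  rw [mul_add, mul_inv_cancel₀ hR.ne'] at this
                  have : 0 ≤ R * ‖ζ - (ω:E)‖ := by positivity
                  linarith
                have h3 := Real.rpow_le_rpow_of_nonpos (z := -N) (by positivity) h2 (by rw [hN]; have : (0:ℝ) ≤ d := by positivity
                                                                                        linarith)
                refine h3.trans (le_of_eq ?_)
                rw [Real.div_rpow (by positivity) (by norm_num), Real.rpow_neg (x := 2) (by norm_num)]
                field_simp
            _ = ENNReal.ofReal ((2:ℝ)^N) * ∫⁻ ω : sphere (0:E) 1, ENNReal.ofReal ((1 + R * ‖ζ - s • (ω:E)‖) ^ (-N)) ∂(volume : Measure E).toSphere :=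
                lintegral_const_mul _ (by fun_prop)
            _ ≤ _ := by
                gcongr
                exact le_mul_of_one_le_left (by positivity) h1
      _ ≤ ∫⁻ s in Set.Ioi (0:ℝ), ENNReal.ofReal ((2:ℝ)^N) * (ENNReal.ofReal (s ^ (d - 1)) *
            ∫⁻ ω : sphere (0:E) 1, ENNReal.ofReal ((1 + R * ‖ζ - s • (ω:E)‖) ^ (-N)) ∂(volume : Measure E).toSphere) := by
          apply lintegral_mono_set
          intro s hs; exact lt_of_lt_of_le one_pos hs.1
      _ = ENNReal.ofReal ((2:ℝ)^N) * ∫⁻ x : E, ENNReal.ofReal ((1 + R * ‖ζ - x‖) ^ (-N)) := by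
          rw [lintegral_const_mul', polar_lint volume _ hmeas]
          exact ENNReal.ofReal_ne_top
      _ = ENNReal.ofReal ((2:ℝ)^N) * (ENNReal.ofReal ((R ^ d)⁻¹) * J) := by
          congr 1
          rw [lintegral_sub_left_eq_self (fun x : E => ENNReal.ofReal ((1 + R * ‖x‖) ^ (-N))) ζ,
            ← lint_smul _ (by fun_prop) R hR]
          simp [norm_smul, abs_of_pos hR]
  have e1 : ENNReal.ofReal (R^d) * A = ENNReal.ofReal (R^d) * ENNReal.ofReal R * (ENNReal.ofReal R⁻¹ * A) := by
    rw [mul_assoc, ← mul_assoc (ENNReal.ofReal R), ← ENNReal.ofReal_mul hR.le, mul_inv_cancel₀ hR.ne']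
    simp
  rw [e1]
  refine (mul_le_mul_right key _).trans ?_
  rw [← ENNReal.ofReal_toReal hfin.ne, ← ENNReal.ofReal_mul (by positivity), ← ENNReal.ofReal_mul (by positivity),
    ← ENNReal.ofReal_mul (by positivity), ← ENNReal.ofReal_mul (by positivity)]
  apply ENNReal.ofReal_le_ofReal
  rw [ENNReal.toReal_ofReal ENNReal.toReal_nonneg]
  apply le_of_eq
  field_simp

lemma psi_exists : ∃ (φ : E → ℝ) (Ψ : ℝ → E → ℂ) (C : ℝ), 0 ≤ C ∧ Continuous φ ∧ (∀ x, 0 ≤ φ x ∧ φ x ≤ 1) ∧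
    (∀ x, ‖x‖ ≤ 1 → φ x = 1) ∧ ∀ R : ℝ, 0 < R → Integrable (Ψ R) ∧ Continuous (Ψ R) ∧
      (∀ z : E, ∫ η, Ψ R η * cexp (2 * Real.pi * ⟪z, η⟫ * I) = (φ (R⁻¹ • z) : ℂ)) ∧
      ∀ ζ : E, ∫⁻ ω : sphere (0:E) 1, ‖Ψ R (ζ - (ω:E))‖ₑ ∂(volume : Measure E).toSphere ≤ ENNReal.ofReal (C * R) := by
  obtain ⟨C0, hC0, hth⟩ := thick (E := E)
  set d := Module.finrank ℝ E with hd
  let b0 : ContDiffBump (0:E) := ⟨1, 2, by norm_num, by norm_num⟩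
  have hcs : HasCompactSupport (fun x : E => (b0 x : ℂ)) := b0.hasCompactSupport.comp_left (g := fun x : ℝ => (x:ℂ)) (by simp)
  have hsm : ContDiff ℝ (⊤ : ℕ∞) (fun x : E => (b0 x : ℂ)) := Complex.ofRealCLM.contDiff.comp b0.contDiff
  let φ : 𝓢(E, ℂ) := hcs.toSchwartzMap hsm
  have hφ : ∀ x, φ x = (b0 x : ℂ) := fun x => rfl
  let χ : 𝓢(E, ℂ) := 𝓕 φ
  have hinv : 𝓕⁻ χ = φ := FourierTransform.fourierInv_fourier_eq φ
  obtain ⟨C1, hC1, hdec⟩ : ∃ C1 : ℝ, 0 ≤ C1 ∧ ∀ x, ‖χ x‖ ≤ C1 * (1 + ‖x‖) ^ (-((d:ℝ) + 1)) := by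
    have := fun x => SchwartzMap.one_add_le_sup_seminorm_apply (𝕜 := ℝ) (m := (d+1, 0)) (k := d+1) (n := 0) le_rfl le_rfl χ x
    generalize 2 ^ (d + 1, 0).1 * ((Finset.Iic (d + 1, 0)).sup fun m => SchwartzMap.seminorm ℝ m.1 m.2) χ = K at this
    refine ⟨K, le_trans (by positivity) (this 0), fun x => ?_⟩
    · have h := this x
      rw [norm_iteratedFDeriv_zero] at h
      have e1 : (1 + ‖x‖) ^ (-((d:ℝ) + 1)) = ((1 + ‖x‖) ^ (d+1))⁻¹ := by
        rw [Real.rpow_neg (by positivity)]; congr 1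
        exact_mod_cast Real.rpow_natCast (1 + ‖x‖) (d+1)
      rw [e1, ← div_eq_mul_inv, le_div_iff₀ (by positivity), mul_comm]
      exact h
  refine ⟨b0, fun R η => ((R^d:ℝ):ℂ) * χ (R • η), C1 * C0, by positivity, b0.continuous, fun x => ⟨b0.nonneg, b0.le_one⟩, ?_, ?_⟩
  · intro x hx
    exact b0.one_of_mem_closedBall (by simpa using hx)
  intro R hR
  refine ⟨?_, ?_, ?_, ?_⟩
  · exact (χ.integrable.comp_smul hR.ne').const_mul _
  · have := χ.continuous; fun_prop
  · intro z
    have h1 : ∀ η : E, ((R^d:ℝ):ℂ) * χ (R • η) * cexp (2 * Real.pi * ⟪z, η⟫ * I) =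
        ((R^d:ℝ):ℂ) * (fun ξ => χ ξ * cexp (2 * Real.pi * ⟪R⁻¹ • z, ξ⟫ * I)) (R • η) := by
      intro η
      simp only [inner_smul_left, inner_smul_right, conj_trivial]
      rw [mul_inv_cancel_left₀ hR.ne', mul_assoc]
    simp_rw [h1]
    rw [integral_const_mul, Measure.integral_comp_smul_of_nonneg volume
      (fun ξ => χ ξ * cexp (2 * Real.pi * ⟪R⁻¹ • z, ξ⟫ * I)) R (hR := hR.le)]
    have h2 : ∫ ξ, χ ξ * cexp (2 * Real.pi * ⟪R⁻¹ • z, ξ⟫ * I) = 𝓕⁻ χ (R⁻¹ • z) := by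
      rw [SchwartzMap.fourierInv_coe, Real.fourierInv_eq']
      congr 1; ext ξ
      rw [smul_eq_mul, mul_comm, real_inner_comm]
      push_cast; rfl
    rw [h2, hinv, hφ, Complex.real_smul, ← mul_assoc, ← Complex.ofReal_mul, mul_inv_cancel₀ (by positivity)]
    simp
  · intro ζ
    calc _ ≤ ∫⁻ ω : sphere (0:E) 1, ENNReal.ofReal (C1 * R^d) * ENNReal.ofReal ((1 + R * ‖ζ - (ω:E)‖) ^ (-((d : ℝ) + 1))) ∂(volume : Measure E).toSphere := by
          apply lintegral_mono
          intro ω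
          show ‖((R^d:ℝ):ℂ) * χ (R • (ζ - (ω:E)))‖ₑ ≤ ENNReal.ofReal _ * ENNReal.ofReal _
          rw [← ENNReal.ofReal_mul (by positivity), ← ofReal_norm]
          apply ENNReal.ofReal_le_ofReal
          rw [norm_mul, Complex.norm_real, Real.norm_of_nonneg (by positivity)]
          have := hdec (R • (ζ - (ω:E)))
          rw [norm_smul, Real.norm_of_nonneg hR.le] at this
          calc _ ≤ R^d * _ := mul_le_mul_of_nonneg_left this (by positivity)
            _ = _ := by ring
      _ = ENNReal.ofReal C1 * (ENNReal.ofReal (R^d) * ∫⁻ ω : sphere (0:E) 1, ENNReal.ofReal ((1 + R * ‖ζ - (ω:E)‖) ^ (-((d : ℝ) + 1))) ∂(volume : Measure E).toSphere) := by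
          rw [lintegral_const_mul _ (by fun_prop), ENNReal.ofReal_mul hC1, mul_assoc]
      _ ≤ ENNReal.ofReal C1 * ENNReal.ofReal (C0 * R) := by gcongr; exact hth R hR ζ
      _ = _ := by rw [← ENNReal.ofReal_mul hC1, mul_assoc]

end sphere
end WL

namespace WL

section sphere
variable {E : Type*} [NormedAddCommGroup E] [InnerProductSpace ℝ E] [FiniteDimensional ℝ E]
  [MeasurableSpace E] [BorelSpace E] [Nontrivial E]

lemma norm_e (r : ℝ) : ‖cexp (2 * Real.pi * r * I)‖ = 1 := by
  have : (2 * Real.pi * r * I : ℂ) = ((2 * Real.pi * r : ℝ):ℂ) * I := by push_cast; ring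
  rw [this, Complex.norm_exp_ofReal_mul_I]

lemma four_cont (u : E → ℂ) (hu : Integrable u) : Continuous (𝓕 u) :=
    VectorFourier.fourierIntegral_continuous Real.continuous_fourierChar
      (by simpa using! continuous_inner) hu

lemma fub {Q : Type*} [MeasurableSpace Q] (ν : Measure Q) [SFinite ν] (ψ : Q → ℂ) (hψ : Integrable ψ ν)
    (θ : Q → E) (hθ : Measurable θ) (u : E → ℂ) (hu : Integrable u) :
    Integrable (fun z : E × E => (u z.1 * (starRingEnd ℂ) (u z.2)) * ∫ q, ψ q * cexp (2 * Real.pi * ⟪z.2 - z.1, θ q⟫ * I) ∂ν)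
      ((volume : Measure E).prod volume) ∧
    ∫ q, ψ q * (𝓕 u (θ q) * (starRingEnd ℂ) (𝓕 u (θ q))) ∂ν =
    ∫ z : E × E, (u z.1 * (starRingEnd ℂ) (u z.2)) * ∫ q, ψ q * cexp (2 * Real.pi * ⟪z.2 - z.1, θ q⟫ * I) ∂ν
      ∂((volume : Measure E).prod volume) := by
  have huc : Integrable (fun x => (starRingEnd ℂ) (u x)) := (Complex.conjLIE.integrable_comp_iff).2 hu
  have hH : Integrable (fun w : Q × (E × E) => (ψ w.1 * (u w.2.1 * (starRingEnd ℂ) (u w.2.2))) *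
      cexp (2 * Real.pi * ⟪w.2.2 - w.2.1, θ w.1⟫ * I)) (ν.prod ((volume : Measure E).prod volume)) := by
    refine (hψ.mul_prod (hu.mul_prod huc)).mul_bdd (c := 1) ?_ ?_
    · apply Measurable.aestronglyMeasurable
      fun_prop
    · exact Filter.Eventually.of_forall fun w => (norm_e _).le
  have e1 : ∀ z : E × E, (u z.1 * (starRingEnd ℂ) (u z.2)) * ∫ q, ψ q * cexp (2 * Real.pi * ⟪z.2 - z.1, θ q⟫ * I) ∂ν =
      ∫ q, (ψ q * (u z.1 * (starRingEnd ℂ) (u z.2))) * cexp (2 * Real.pi * ⟪z.2 - z.1, θ q⟫ * I) ∂ν := by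
    intro z
    rw [← integral_const_mul]
    congr 1; ext q; ring
  simp_rw [e1]
  refine ⟨hH.integral_prod_right, ?_⟩
  rw [← integral_integral_swap hH]
  congr 1; ext q
  have e2 : 𝓕 u (θ q) = ∫ x, u x * cexp (2 * Real.pi * (-⟪x, θ q⟫ : ℝ) * I) := by
    rw [Real.fourier_eq']
    congr 1; ext x
    rw [smul_eq_mul, mul_comm]; push_cast; ring_nf
  have e3 : (starRingEnd ℂ) (𝓕 u (θ q)) = ∫ x, (starRingEnd ℂ) (u x) * cexp (2 * Real.pi * ⟪x, θ q⟫ * I) := by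
    rw [e2, ← integral_conj]
    congr 1; ext x
    rw [map_mul, ← Complex.exp_conj]
    congr 2
    simp only [map_mul, Complex.conj_ofReal, Complex.conj_I, map_ofNat]
    push_cast; ring
  rw [e3, e2, ← integral_prod_mul, ← integral_const_mul]
  congr 1; ext z
  have : cexp (2 * Real.pi * ⟪z.2 - z.1, θ q⟫ * I) = cexp (2 * Real.pi * (-⟪z.1, θ q⟫ : ℝ) * I) * cexp (2 * Real.pi * ⟪z.2, θ q⟫ * I) := by
    rw [← Complex.exp_add, inner_sub_left]; congr 1; push_cast; ring
  rw [this]; ring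

lemma Dbound : ∃ C : ℝ, 0 ≤ C ∧ ∀ R : ℝ, 0 < R → ∀ u : E → ℂ, Integrable u → MemLp u 2 volume →
    ∫⁻ ω : sphere (0:E) 1, ‖𝓕 u (ω:E)‖ₑ^2 ∂(volume : Measure E).toSphere ≤
      ENNReal.ofReal (C * R) * (∫⁻ x, ‖u x‖ₑ^2) +
      ∫⁻ z : E × E, ‖u z.1‖ₑ * ‖u z.2‖ₑ * Set.indicator {y : E | R < ‖y‖} (fun y => ‖sig y‖ₑ) (z.2 - z.1) ∂((volume : Measure E).prod volume) := by
  obtain ⟨φ, Ψ, C, hC, hφc, hφ, hφ1, hΨ⟩ := psi_exists (E := E)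
  refine ⟨C, hC, ?_⟩
  intro R hR u hu hu2
  obtain ⟨hΨi, hΨc, hΨf, hΨb⟩ := hΨ R hR
  set σ := (volume : Measure E).toSphere with hσ
  obtain ⟨i1, f1⟩ := fub σ (fun _ => (1:ℂ)) (integrable_const _) (fun ω : sphere (0:E) 1 => (ω:E)) (by fun_prop) u hu
  obtain ⟨i2, f2⟩ := fub (σ.prod (volume : Measure E)) (fun q : sphere (0:E) 1 × E => (1:ℂ) * Ψ R q.2)
    ((integrable_const _).mul_prod hΨi) (fun q => (q.1:E) + q.2) (by fun_prop) u hu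
  have hcont := four_cont u hu
  have k1 : ∀ z : E, ∫ ω : sphere (0:E) 1, (1:ℂ) * cexp (2 * Real.pi * ⟪z, (ω:E)⟫ * I) ∂σ = sig z := by
    intro z; simp [sig, hσ]
  have k2 : ∀ z : E, ∫ q : sphere (0:E) 1 × E, (1:ℂ) * Ψ R q.2 * cexp (2 * Real.pi * ⟪z, (q.1:E) + q.2⟫ * I) ∂(σ.prod volume)
      = sig z * φ (R⁻¹ • z) := by
    intro z
    rw [← hΨf z, ← k1, ← integral_prod_mul]
    congr 1; ext q
    rw [inner_add_right]
    have : cexp (2 * Real.pi * (⟪z, (q.1:E)⟫ + ⟪z, q.2⟫ : ℝ) * I) = cexp (2 * Real.pi * ⟪z, (q.1:E)⟫ * I) * cexp (2 * Real.pi * ⟪z, q.2⟫ * I) := by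
      rw [← Complex.exp_add]; congr 1; push_cast; ring
    rw [this]; ring
  simp only [k1] at i1 f1
  simp only [k2] at i2 f2
  set D := ∫ ω : sphere (0:E) 1, (1:ℂ) * (𝓕 u (ω:E) * (starRingEnd ℂ) (𝓕 u (ω:E))) ∂σ with hD
  set D1 := ∫ q : sphere (0:E) 1 × E, (1:ℂ) * Ψ R q.2 * (𝓕 u ((q.1:E) + q.2) * (starRingEnd ℂ) (𝓕 u ((q.1:E) + q.2))) ∂(σ.prod volume) with hD1
  have hDeq : ∫⁻ ω : sphere (0:E) 1, ‖𝓕 u (ω:E)‖ₑ^2 ∂σ = ‖D‖ₑ := by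
    have : D = ((∫ ω : sphere (0:E) 1, ‖𝓕 u (ω:E)‖^2 ∂σ : ℝ) : ℂ) := by
      rw [hD, ← integral_complex_ofReal]
      congr 1; ext ω
      rw [one_mul, Complex.mul_conj, Complex.normSq_eq_norm_sq]
    rw [this, ← ofReal_norm, Complex.norm_real, Real.norm_of_nonneg (by positivity),
      ofReal_integral_eq_lintegral_ofReal]
    · congr 1; ext ω; rw [ENNReal.ofReal_pow (norm_nonneg _), ofReal_norm]
    · have hc : Continuous (fun ω : sphere (0:E) 1 => ‖𝓕 u (ω:E)‖^2) := by fun_prop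
      exact hc.integrable_of_hasCompactSupport (HasCompactSupport.of_compactSpace _)
    · exact Filter.Eventually.of_forall fun ω => by positivity
  have hD1b : ‖D1‖ₑ ≤ ENNReal.ofReal (C * R) * ∫⁻ x, ‖u x‖ₑ^2 := by
    calc ‖D1‖ₑ ≤ ∫⁻ q : sphere (0:E) 1 × E, ‖Ψ R q.2‖ₑ * ‖𝓕 u ((q.1:E) + q.2)‖ₑ^2 ∂(σ.prod volume) := by
          refine (enorm_integral_le_lintegral_enorm _).trans (le_of_eq ?_)
          congr 1; ext q
          rw [enorm_mul, enorm_mul, enorm_mul, RCLike.enorm_conj, enorm_one, one_mul, sq]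
      _ = ∫⁻ ω : sphere (0:E) 1, (∫⁻ η : E, ‖Ψ R η‖ₑ * ‖𝓕 u ((ω:E) + η)‖ₑ^2) ∂σ := by
          rw [lintegral_prod]
          apply Measurable.aemeasurable; fun_prop
      _ = ∫⁻ ω : sphere (0:E) 1, (∫⁻ ζ : E, ‖Ψ R (ζ - (ω:E))‖ₑ * ‖𝓕 u ζ‖ₑ^2) ∂σ := by
          congr 1; ext ω
          rw [← lintegral_add_left_eq_self (fun ζ : E => ‖Ψ R (ζ - (ω:E))‖ₑ * ‖𝓕 u ζ‖ₑ^2) (ω:E)]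
          simp
      _ = ∫⁻ ζ : E, ∫⁻ ω : sphere (0:E) 1, ‖Ψ R (ζ - (ω:E))‖ₑ * ‖𝓕 u ζ‖ₑ^2 ∂σ := by
          rw [lintegral_lintegral_swap]
          apply Measurable.aemeasurable
          show Measurable fun q : sphere (0:E) 1 × E => ‖Ψ R (q.2 - (q.1:E))‖ₑ * ‖𝓕 u q.2‖ₑ^2
          fun_prop
      _ ≤ ∫⁻ ζ : E, ENNReal.ofReal (C * R) * ‖𝓕 u ζ‖ₑ^2 := by
          apply lintegral_mono
          intro ζ
          show ∫⁻ ω : sphere (0:E) 1, ‖Ψ R (ζ - (ω:E))‖ₑ * ‖𝓕 u ζ‖ₑ^2 ∂σ ≤ ENNReal.ofReal (C * R) * ‖𝓕 u ζ‖ₑ^2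
          rw [lintegral_mul_const' _ _ (by simp)]
          exact mul_le_mul_left (hΨb ζ) _
      _ = _ := by
          rw [lintegral_const_mul' _ _ (by simp), planch_lint u hu hu2]
  have hdiff : ‖D - D1‖ₑ ≤ ∫⁻ z : E × E, ‖u z.1‖ₑ * ‖u z.2‖ₑ * Set.indicator {y : E | R < ‖y‖} (fun y => ‖sig y‖ₑ) (z.2 - z.1) ∂((volume : Measure E).prod volume) := by
    rw [f1, f2, ← integral_sub i1 i2]
    refine (enorm_integral_le_lintegral_enorm _).trans (lintegral_mono fun z => ?_)
    set y := z.2 - z.1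
    have : u z.1 * (starRingEnd ℂ) (u z.2) * sig y - u z.1 * (starRingEnd ℂ) (u z.2) * (sig y * φ (R⁻¹ • y)) =
      u z.1 * (starRingEnd ℂ) (u z.2) * (sig y * ((1 - φ (R⁻¹ • y) : ℝ) : ℂ)) := by push_cast; ring
    simp only [this]
    rw [enorm_mul, enorm_mul, RCLike.enorm_conj]
    refine mul_le_mul_right ?_ _
    by_cases hy : R < ‖y‖
    · rw [Set.indicator_of_mem (show y ∈ {y : E | R < ‖y‖} from hy), enorm_mul]
      refine mul_le_of_le_one_right' ?_
      rw [← ofReal_norm, Complex.norm_real, ENNReal.ofReal_le_one, Real.norm_eq_abs, abs_le]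
      have := hφ (R⁻¹ • y)
      constructor <;> linarith [this.1, this.2]
    · have h1 : φ (R⁻¹ • y) = 1 := by
        apply hφ1
        rw [norm_smul, norm_inv, Real.norm_of_nonneg hR.le, inv_mul_le_one₀ hR]
        exact not_lt.1 hy
      simp [h1]
  rw [hDeq]
  calc ‖D‖ₑ = ‖D1 + (D - D1)‖ₑ := by congr 1; ring
    _ ≤ ‖D1‖ₑ + ‖D - D1‖ₑ := enorm_add_le _ _
    _ ≤ _ := add_le_add hD1b hdiff

end sphere
end WL

namespace WL

section sphere
variable {E : Type*} [NormedAddCommGroup E] [InnerProductSpace ℝ E] [FiniteDimensional ℝ E]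
  [MeasurableSpace E] [BorelSpace E] [Nontrivial E]

def FP (p : ℝ) (w : E → ℝ) : Prop := ∀ (x : E) (r : ℝ), 0 < r →
  ∫⁻ y in ball x r, ENNReal.ofReal (w y ^ p) ≤ ENNReal.ofReal (r ^ ((Module.finrank ℝ E : ℝ) - 2 * p))

lemma norm_sig_neg (z : E) : ‖sig (-z)‖ = ‖sig z‖ := by
  have : sig (-z) = (starRingEnd ℂ) (sig z) := by
    unfold sig
    rw [← integral_conj]
    congr 1; ext ω
    rw [← Complex.exp_conj]
    congr 1
    simp only [map_mul, Complex.conj_ofReal, Complex.conj_I, map_ofNat, inner_neg_left]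
    push_cast; ring
  rw [this, RCLike.norm_conj]

lemma sig_meas : Measurable (sig : E → ℂ) := by
  apply StronglyMeasurable.measurable
  unfold sig
  apply StronglyMeasurable.integral_prod_right' (f := fun q : E × sphere (0:E) 1 => cexp (2 * Real.pi * ⟪q.1, (q.2:E)⟫ * I))
  apply Measurable.stronglyMeasurable
  fun_prop

lemma shell (hd : 3 ≤ Module.finrank ℝ E) (p : ℝ) (hp : ((Module.finrank ℝ E : ℝ) - 1)/2 < p) :
    ∃ C : ℝ, 0 ≤ C ∧ ∀ w : E → ℝ, Measurable w → FP p w → ∀ R : ℝ, 1 ≤ R → ∀ x : E,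
    ∫⁻ y in {y : E | R ≤ ‖y - x‖}, ‖sig (y - x)‖ₑ * ENNReal.ofReal (w y ^ p) ≤
      ENNReal.ofReal (C * R ^ (-(2 * p - ((Module.finrank ℝ E : ℝ) - 1)/2 - 1))) := by
  obtain ⟨C0, hC0, hsig⟩ := sig_decay (E := E) (by omega)
  set d := Module.finrank ℝ E with hdd
  have hd3 : (3:ℝ) ≤ d := by exact_mod_cast hd
  set a : ℝ := ((d:ℝ) - 1)/2 with ha
  set β : ℝ := 2 * p - a - 1 with hβ
  have hβ0 : 0 < β := by rw [hβ]; linarith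
  have hβd : -a + ((d:ℝ) - 2 * p) = -β := by rw [hβ, ha]; ring
  set q : ℝ := (2:ℝ) ^ (-β) with hq
  have hq0 : 0 ≤ q := by positivity
  have hq1 : q < 1 := Real.rpow_lt_one_of_one_lt_of_neg (by norm_num) (by linarith)
  have hq2 : 0 < 1 - q := by linarith
  refine ⟨C0 * 2 ^ ((d:ℝ) - 2 * p) * (1 - q)⁻¹, by positivity, ?_⟩
  intro w hw hFP R hR x
  have hR0 : 0 < R := by linarith
  have hcover : {y : E | R ≤ ‖y - x‖} ⊆ ⋃ j : ℕ, (ball x (2^(j+1) * R) ∩ {y : E | 2^j * R ≤ ‖y - x‖}) := by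
    intro y hy
    have hy : R ≤ ‖y - x‖ := hy
    obtain ⟨j, hj1, hj2⟩ := exists_nat_pow_near (x := ‖y - x‖ / R) (y := 2) (by rwa [one_le_div hR0]) (by norm_num)
    rw [Set.mem_iUnion]
    refine ⟨j, ?_, ?_⟩
    · rw [mem_ball, dist_eq_norm]; rwa [div_lt_iff₀ hR0] at hj2
    · rwa [le_div_iff₀ hR0] at hj1
  have hterm : ∀ j : ℕ, ∫⁻ y in (ball x (2^(j+1) * R) ∩ {y : E | 2^j * R ≤ ‖y - x‖}), ‖sig (y - x)‖ₑ * ENNReal.ofReal (w y ^ p) ≤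
      ENNReal.ofReal (C0 * 2 ^ ((d:ℝ) - 2 * p) * R ^ (-β) * q ^ j) := by
    intro j
    have h2j : (1:ℝ) ≤ 2^j := one_le_pow₀ (by norm_num)
    have hRj : 1 ≤ 2^j * R := by nlinarith
    calc _ ≤ ∫⁻ y in (ball x (2^(j+1) * R) ∩ {y : E | 2^j * R ≤ ‖y - x‖}), ENNReal.ofReal (C0 * (2^j * R) ^ (-a)) * ENNReal.ofReal (w y ^ p) := by
          apply setLIntegral_mono' (measurableSet_ball.inter (measurableSet_le (by fun_prop) (by fun_prop)))
          intro y hy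
          have hy2 : 2^j * R ≤ ‖y - x‖ := hy.2
          gcongr
          rw [← ofReal_norm]
          apply ENNReal.ofReal_le_ofReal
          refine ((hsig (y - x)).2 (hRj.trans hy2)).trans ?_
          exact mul_le_mul_of_nonneg_left (Real.rpow_le_rpow_of_nonpos (z := -a) (by positivity) hy2 (by rw [ha]; linarith)) hC0.le
      _ ≤ ∫⁻ y in ball x (2^(j+1) * R), ENNReal.ofReal (C0 * (2^j * R) ^ (-a)) * ENNReal.ofReal (w y ^ p) :=
          lintegral_mono_set Set.inter_subset_left
      _ = ENNReal.ofReal (C0 * (2^j * R) ^ (-a)) * ∫⁻ y in ball x (2^(j+1) * R), ENNReal.ofReal (w y ^ p) :=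
          lintegral_const_mul' _ _ (by simp)
      _ ≤ ENNReal.ofReal (C0 * (2^j * R) ^ (-a)) * ENNReal.ofReal ((2^(j+1) * R) ^ ((d:ℝ) - 2 * p)) := by
          gcongr
          exact hFP x _ (by positivity)
      _ = _ := by
          rw [← ENNReal.ofReal_mul (by positivity)]
          congr 1
          have e1 : (2^(j+1) * R : ℝ) = 2 * (2^j * R) := by ring
          rw [e1, Real.mul_rpow (x := 2) (y := 2^j * R) (by norm_num) (by positivity)]
          have e2 : q ^ j = ((2:ℝ)^j) ^ (-β) := by
            rw [hq, ← Real.rpow_natCast, ← Real.rpow_natCast, ← Real.rpow_mul (by norm_num), ← Real.rpow_mul (by norm_num), mul_comm]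
          have e3 : (2^j * R) ^ (-a) * (2^j * R) ^ ((d:ℝ) - 2 * p) = R ^ (-β) * q ^ j := by
            rw [← Real.rpow_add (by positivity), hβd, Real.mul_rpow (by positivity) hR0.le, e2, mul_comm]
          linear_combination C0 * 2 ^ ((d:ℝ) - 2 * p) * e3
  calc _ ≤ ∫⁻ y in ⋃ j : ℕ, (ball x (2^(j+1) * R) ∩ {y : E | 2^j * R ≤ ‖y - x‖}), ‖sig (y - x)‖ₑ * ENNReal.ofReal (w y ^ p) :=
        lintegral_mono_set hcover
    _ ≤ ∑' j : ℕ, ∫⁻ y in (ball x (2^(j+1) * R) ∩ {y : E | 2^j * R ≤ ‖y - x‖}), ‖sig (y - x)‖ₑ * ENNReal.ofReal (w y ^ p) :=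
        lintegral_iUnion_le _ _
    _ ≤ ∑' j : ℕ, ENNReal.ofReal (C0 * 2 ^ ((d:ℝ) - 2 * p) * R ^ (-β) * q ^ j) := ENNReal.tsum_le_tsum hterm
    _ = ENNReal.ofReal (∑' j : ℕ, C0 * 2 ^ ((d:ℝ) - 2 * p) * R ^ (-β) * q ^ j) := by
        rw [ENNReal.ofReal_tsum_of_nonneg]
        · intro j; positivity
        · exact (summable_geometric_of_lt_one hq0 hq1).mul_left _
    _ = _ := by
        rw [tsum_mul_left, tsum_geometric_of_lt_one hq0 hq1]
        congr 1; ring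

lemma schur (hd : 3 ≤ Module.finrank ℝ E) (p : ℝ) (hp : ((Module.finrank ℝ E : ℝ) - 1)/2 < p) :
    ∃ C : ℝ, 0 ≤ C ∧ ∀ w : E → ℝ, Measurable w → FP p w → ∀ R : ℝ, 0 < R → ∀ x : E,
    ∫⁻ y, Set.indicator {y : E | R < ‖y‖} (fun y => ‖sig y‖ₑ) (y - x) * ENNReal.ofReal (w y ^ p) ≤
      ENNReal.ofReal (C * min 1 (R ^ (-(2 * p - ((Module.finrank ℝ E : ℝ) - 1)/2 - 1)))) := by
  obtain ⟨C1, hC1, hsh⟩ := shell hd p hp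
  obtain ⟨C0, hC0, hsig⟩ := sig_decay (E := E) (by omega)
  set d := Module.finrank ℝ E with hdd
  have hd3 : (3:ℝ) ≤ d := by exact_mod_cast hd
  set β : ℝ := 2 * p - ((d:ℝ) - 1)/2 - 1 with hβ
  have hβ0 : 0 < β := by rw [hβ]; linarith
  refine ⟨C0 + C1, by positivity, ?_⟩
  intro w hw hFP R hR x
  by_cases hR1 : 1 ≤ R
  · have : min 1 (R ^ (-β)) = R ^ (-β) := min_eq_right (Real.rpow_le_one_of_one_le_of_nonpos hR1 (by linarith))
    rw [this]
    calc _ ≤ ∫⁻ y, Set.indicator {y : E | R ≤ ‖y - x‖} (fun y => ‖sig (y - x)‖ₑ * ENNReal.ofReal (w y ^ p)) y := by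
          apply lintegral_mono
          intro y
          by_cases h : R < ‖y - x‖
          · have h1 : y - x ∈ {y : E | R < ‖y‖} := h
            have h2 : y ∈ {y : E | R ≤ ‖y - x‖} := h.le
            simp only [Set.indicator_of_mem h1, Set.indicator_of_mem h2, le_refl]
          · have h1 : y - x ∉ {y : E | R < ‖y‖} := h
            simp only [Set.indicator_of_notMem h1, zero_mul, zero_le]
      _ = ∫⁻ y in {y : E | R ≤ ‖y - x‖}, ‖sig (y - x)‖ₑ * ENNReal.ofReal (w y ^ p) :=
          lintegral_indicator (measurableSet_le (by fun_prop) (by fun_prop)) _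
      _ ≤ _ := hsh w hw hFP R hR1 x
      _ ≤ _ := by
          apply ENNReal.ofReal_le_ofReal
          gcongr; linarith
  · push Not at hR1
    have : min 1 (R ^ (-β)) = 1 := min_eq_left (Real.one_le_rpow_of_pos_of_le_one_of_nonpos hR hR1.le (by linarith))
    rw [this, mul_one]
    calc _ ≤ ∫⁻ y, ‖sig (y - x)‖ₑ * ENNReal.ofReal (w y ^ p) := by
          apply lintegral_mono
          intro y
          exact mul_le_mul_left (Set.indicator_le_self' (fun _ _ => zero_le) _) _
      _ = (∫⁻ y in ball x 1, ‖sig (y - x)‖ₑ * ENNReal.ofReal (w y ^ p)) + ∫⁻ y in (ball x 1)ᶜ, ‖sig (y - x)‖ₑ * ENNReal.ofReal (w y ^ p) :=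
          (lintegral_add_compl _ measurableSet_ball).symm
      _ ≤ ENNReal.ofReal C0 + ENNReal.ofReal C1 := by
          gcongr
          · calc _ ≤ ∫⁻ y in ball x 1, ENNReal.ofReal C0 * ENNReal.ofReal (w y ^ p) := by
                  apply lintegral_mono
                  intro y
                  refine mul_le_mul_left ?_ _
                  rw [← ofReal_norm]
                  exact ENNReal.ofReal_le_ofReal (hsig _).1
              _ = ENNReal.ofReal C0 * ∫⁻ y in ball x 1, ENNReal.ofReal (w y ^ p) := lintegral_const_mul' _ _ (by simp)
              _ ≤ ENNReal.ofReal C0 * 1 := by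
                  gcongr
                  have := hFP x 1 one_pos
                  simpa using this
              _ = _ := mul_one _
          · have hs : (ball x 1)ᶜ = {y : E | (1:ℝ) ≤ ‖y - x‖} := by
              ext y; simp [dist_eq_norm]
            rw [hs]
            have := hsh w hw hFP 1 le_rfl x
            simpa using this
      _ = _ := (ENNReal.ofReal_add hC0.le hC1).symm
end sphere
end WL

namespace WL

section sphere
variable {E : Type*} [NormedAddCommGroup E] [InnerProductSpace ℝ E] [FiniteDimensional ℝ E]
  [MeasurableSpace E] [BorelSpace E] [Nontrivial E]

def ext (g : sphere (0:E) 1 → ℂ) (x : E) : ℂ :=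
  ∫ ω : sphere (0:E) 1, cexp (2 * Real.pi * ⟪x, (ω:E)⟫ * I) * g ω ∂(volume : Measure E).toSphere

lemma ext_meas (g : sphere (0:E) 1 → ℂ) (hg : Continuous g) : Measurable (ext g) := by
  apply StronglyMeasurable.measurable
  unfold ext
  apply StronglyMeasurable.integral_prod_right' (f := fun q : E × sphere (0:E) 1 => cexp (2 * Real.pi * ⟪q.1, (q.2:E)⟫ * I) * g q.2)
  apply Measurable.stronglyMeasurable
  have := hg.measurable
  fun_prop

lemma ext_bound (g : sphere (0:E) 1 → ℂ) (x : E) :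
    ‖ext g x‖ ≤ ∫ ω, ‖g ω‖ ∂(volume : Measure E).toSphere := by
  refine (norm_integral_le_integral_norm _).trans (le_of_eq ?_)
  congr 1; ext ω
  rw [norm_mul, norm_e, one_mul]

lemma dual (g : sphere (0:E) 1 → ℂ) (hg : Continuous g) (u : E → ℂ) (hu : Integrable u) :
    ∫ x, u x * (starRingEnd ℂ) (ext g x) =
      ∫ ω : sphere (0:E) 1, (starRingEnd ℂ) (g ω) * 𝓕 u (ω:E) ∂(volume : Measure E).toSphere := by
  have hgi := sph_int (fun ω => (starRingEnd ℂ) (g ω)) (Complex.continuous_conj.comp hg)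
  have hH : Integrable (fun w : E × sphere (0:E) 1 => (u w.1 * (starRingEnd ℂ) (g w.2)) *
      cexp (2 * Real.pi * (-⟪w.1, (w.2:E)⟫ : ℝ) * I)) ((volume : Measure E).prod (volume : Measure E).toSphere) := by
    refine (hu.mul_prod hgi).mul_bdd (c := 1) ?_ ?_
    · apply Measurable.aestronglyMeasurable
      fun_prop
    · exact Filter.Eventually.of_forall fun w => (norm_e _).le
  have e1 : ∀ x, u x * (starRingEnd ℂ) (ext g x) = ∫ ω : sphere (0:E) 1, (u x * (starRingEnd ℂ) (g ω)) *
      cexp (2 * Real.pi * (-⟪x, (ω:E)⟫ : ℝ) * I) ∂(volume : Measure E).toSphere := by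
    intro x
    unfold ext
    rw [← integral_conj, ← integral_const_mul]
    congr 1; ext ω
    rw [map_mul, ← Complex.exp_conj]
    have : (starRingEnd ℂ) (2 * Real.pi * ⟪x, (ω:E)⟫ * I) = 2 * Real.pi * (-⟪x, (ω:E)⟫ : ℝ) * I := by
      simp only [map_mul, Complex.conj_ofReal, Complex.conj_I, map_ofNat]
      push_cast; ring
    rw [this]; ring
  simp_rw [e1]
  rw [integral_integral_swap hH]
  congr 1; ext ω
  have e2 : 𝓕 u (ω:E) = ∫ x, u x * cexp (2 * Real.pi * (-⟪x, (ω:E)⟫ : ℝ) * I) := by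
    rw [Real.fourier_eq']
    congr 1; ext x
    rw [smul_eq_mul, mul_comm]; push_cast; ring_nf
  rw [e2, ← integral_const_mul]
  congr 1; ext x; ring

lemma enn_mul_le (a b : ℝ≥0∞) : a * b ≤ a^2 + b^2 := by
  rcases le_total a b with h | h
  · calc a * b ≤ b * b := by gcongr
      _ = b^2 := by ring
      _ ≤ _ := le_add_self
  · calc a * b ≤ a * a := by gcongr
      _ = a^2 := by ring
      _ ≤ _ := le_self_add

/-- level estimate with free `R` -/
lemma level0 (hd : 3 ≤ Module.finrank ℝ E) (p : ℝ) (hp : ((Module.finrank ℝ E : ℝ) - 1)/2 < p) :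
    ∃ C : ℝ, 0 ≤ C ∧ ∀ w : E → ℝ, Measurable w → (∀ x, 0 ≤ w x) → FP p w → ∀ l M : ℝ, 0 < l →
      (∀ x, w x ≠ 0 → ‖x‖ < M ∧ l ≤ w x ∧ w x ≤ 2 * l) → ∀ R : ℝ, 0 < R →
      ∀ g : sphere (0:E) 1 → ℂ, Continuous g →
      ∫⁻ x, ‖ext g x‖ₑ^2 * ENNReal.ofReal (w x) ≤
      ENNReal.ofReal (C * (R * l + l ^ (1 - p) * min 1 (R ^ (-(2 * p - ((Module.finrank ℝ E : ℝ) - 1)/2 - 1))))) *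
        ∫⁻ ω, ‖g ω‖ₑ^2 ∂(volume : Measure E).toSphere := by
  obtain ⟨C1, hC1, hD⟩ := Dbound (E := E)
  obtain ⟨C2, hC2, hS⟩ := schur hd p hp
  set d := Module.finrank ℝ E with hdd
  have hd3 : (3:ℝ) ≤ d := by exact_mod_cast hd
  set β : ℝ := 2 * p - ((d:ℝ) - 1)/2 - 1 with hβ
  refine ⟨2 * C1 + 2 * C2, by positivity, ?_⟩
  intro w hw hw0 hFP l M hl hsupp R hR g hg
  set σ := (volume : Measure E).toSphere with hσ
  set K := ∫ ω, ‖g ω‖ ∂σ with hK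
  set m := min 1 (R ^ (-β)) with hm
  have hm0 : 0 ≤ m := le_min zero_le_one (by positivity)
  have hH := ext_meas g hg
  set u : E → ℂ := fun x => (w x : ℂ) * ext g x with hu
  have hum : Measurable u := by fun_prop
  have hw2 : ∀ x, w x ≤ 2 * l := by
    intro x
    by_cases h : w x = 0
    · rw [h]; positivity
    · exact (hsupp x h).2.2
  have hub : ∀ x, ‖u x‖ ≤ 2 * l * K := by
    intro x
    rw [hu]
    simp only [norm_mul, Complex.norm_real, Real.norm_of_nonneg (hw0 x)]
    exact mul_le_mul (hw2 x) (ext_bound g x) (norm_nonneg _) (by positivity)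
  have hus : Function.support u ⊆ ball 0 M := by
    intro x hx
    have : w x ≠ 0 := by
      intro h; apply hx; simp [hu, h]
    simpa using (hsupp x this).1
  have hui : Integrable u := by
    have : IntegrableOn u (ball 0 M) :=
      Measure.integrableOn_of_bounded (M := 2 * l * K) measure_ball_lt_top.ne hum.aestronglyMeasurable
        (Filter.Eventually.of_forall hub)
    rwa [integrableOn_iff_integrable_of_support_subset hus] at this
  have hu2 : MemLp u 2 volume := by
    have ht : MemLp u ⊤ volume := memLp_top_of_bound hum.aestronglyMeasurable (2 * l * K) (Filter.Eventually.of_forall hub)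
    refine ht.mono_exponent_of_measure_support_ne_top
      (s := ball 0 M) (fun x hx => ?_) measure_ball_lt_top.ne le_top
    by_contra h
    exact hx (hus h)
  set J := ∫⁻ x, ‖ext g x‖ₑ^2 * ENNReal.ofReal (w x) with hJ
  set G := ∫⁻ ω, ‖g ω‖ₑ^2 ∂σ with hG
  set D := ∫⁻ ω : sphere (0:E) 1, ‖𝓕 u (ω:E)‖ₑ^2 ∂σ with hDD
  have hui2 : Integrable (fun x => u x * (starRingEnd ℂ) (ext g x)) := by
    refine hui.mul_bdd (c := K) ?_ ?_
    · exact (Complex.continuous_conj.measurable.comp hH).aestronglyMeasurable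
    · exact Filter.Eventually.of_forall fun x => by rw [RCLike.norm_conj]; exact ext_bound g x
  have hpt : ∀ x, u x * (starRingEnd ℂ) (ext g x) = ((‖ext g x‖^2 * w x : ℝ) : ℂ) := by
    intro x
    simp only [hu]
    rw [mul_assoc, Complex.mul_conj, Complex.normSq_eq_norm_sq]; push_cast; ring
  have hJeq : J = ‖∫ x, u x * (starRingEnd ℂ) (ext g x)‖ₑ := by
    simp_rw [hpt] at hui2 ⊢
    have hri : Integrable (fun x => ‖ext g x‖^2 * w x) := by
      have := hui2.re
      simpa only [RCLike.re_to_complex, Complex.ofReal_re] using this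
    have hnn : ∀ x, 0 ≤ ‖ext g x‖^2 * w x := fun x => mul_nonneg (by positivity) (hw0 x)
    rw [integral_complex_ofReal, ← ofReal_norm, Complex.norm_real, Real.norm_of_nonneg (integral_nonneg hnn),
      ofReal_integral_eq_lintegral_ofReal hri (Filter.Eventually.of_forall hnn)]
    rw [hJ]
    congr 1; ext x; rw [ENNReal.ofReal_mul (by positivity), ENNReal.ofReal_pow (norm_nonneg _), ofReal_norm]
  have hJfin : J ≠ ⊤ := by rw [hJeq]; exact enorm_ne_top
  have hCS : J^2 ≤ G * D := by
    have h1 : J ≤ ∫⁻ ω : sphere (0:E) 1, ‖g ω‖ₑ * ‖𝓕 u (ω:E)‖ₑ ∂σ := by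
      rw [hJeq, dual g hg u hui]
      refine (enorm_integral_le_lintegral_enorm _).trans (le_of_eq ?_)
      congr 1; ext ω
      rw [enorm_mul, RCLike.enorm_conj]
    have hcont := four_cont u hui
    have h2 := ENNReal.lintegral_mul_le_Lp_mul_Lq σ Real.HolderConjugate.two_two (f := fun ω : sphere (0:E) 1 => ‖g ω‖ₑ)
      (g := fun ω : sphere (0:E) 1 => ‖𝓕 u (ω:E)‖ₑ) (by fun_prop) (by fun_prop)
    have h3 : J ≤ G ^ (1/(2:ℝ)) * D ^ (1/(2:ℝ)) := by
      refine h1.trans (h2.trans (le_of_eq ?_))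
      simp only [ENNReal.rpow_two]
      rfl
    calc J^2 ≤ (G ^ (1/(2:ℝ)) * D ^ (1/(2:ℝ)))^2 := by gcongr
      _ = G * D := by
        rw [mul_pow, ← ENNReal.rpow_two, ← ENNReal.rpow_two, ← ENNReal.rpow_mul, ← ENNReal.rpow_mul]
        norm_num
  have hwp : ∀ x, ENNReal.ofReal (w x) ≤ ENNReal.ofReal (l ^ (1-p)) * ENNReal.ofReal (w x ^ p) := by
    intro x
    rw [← ENNReal.ofReal_mul (by positivity)]
    apply ENNReal.ofReal_le_ofReal
    by_cases h : w x = 0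
    · rw [h]; positivity
    · have hwl := (hsupp x h).2.1
      have hwpos : 0 < w x := by linarith
      calc w x = w x ^ (1-p) * w x ^ p := by rw [← Real.rpow_add hwpos]; simp
        _ ≤ l ^ (1-p) * w x ^ p := by
          refine mul_le_mul_of_nonneg_right (Real.rpow_le_rpow_of_nonpos hl hwl ?_) (by positivity)
          linarith
  have hu2b : ∫⁻ x, ‖u x‖ₑ^2 ≤ ENNReal.ofReal (2 * l) * J := by
    rw [hJ, ← lintegral_const_mul' _ _ ENNReal.ofReal_ne_top]
    apply lintegral_mono
    intro x
    have : ‖u x‖ₑ = ENNReal.ofReal (w x) * ‖ext g x‖ₑ := by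
      rw [hu]; simp only; rw [enorm_mul, ← ofReal_norm (w x : ℂ), Complex.norm_real, Real.norm_of_nonneg (hw0 x)]
    simp only [this]
    calc (ENNReal.ofReal (w x) * ‖ext g x‖ₑ)^2 = ENNReal.ofReal (w x) * (‖ext g x‖ₑ^2 * ENNReal.ofReal (w x)) := by ring
      _ ≤ _ := by gcongr; exact hw2 x
  set κ : E → ℝ≥0∞ := Set.indicator {y : E | R < ‖y‖} (fun y => ‖sig y‖ₑ) with hκ
  have hκm : Measurable κ := (sig_meas.enorm).indicator (measurableSet_lt (by fun_prop) (by fun_prop))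
  have hκs : ∀ y, κ (-y) = κ y := by
    intro y
    simp only [hκ, Set.indicator, Set.mem_setOf_eq, norm_neg, ← ofReal_norm (sig _), norm_sig_neg]
  have hker : ∀ x, ∫⁻ y, κ (y - x) * ENNReal.ofReal (w y) ≤ ENNReal.ofReal (l^(1-p) * (C2 * m)) := by
    intro x
    calc _ ≤ ∫⁻ y, ENNReal.ofReal (l^(1-p)) * (κ (y - x) * ENNReal.ofReal (w y ^ p)) := by
          apply lintegral_mono
          intro y
          calc κ (y - x) * ENNReal.ofReal (w y) ≤ κ (y - x) * (ENNReal.ofReal (l ^ (1-p)) * ENNReal.ofReal (w y ^ p)) := by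
                gcongr; exact hwp y
            _ = _ := by ring
      _ = ENNReal.ofReal (l^(1-p)) * ∫⁻ y, κ (y - x) * ENNReal.ofReal (w y ^ p) := lintegral_const_mul' _ _ (by simp)
      _ ≤ ENNReal.ofReal (l^(1-p)) * ENNReal.ofReal (C2 * m) := by
          gcongr
          exact hS w hw hFP R hR x
      _ = _ := (ENNReal.ofReal_mul (by positivity)).symm
  have hdbl : ∫⁻ z : E × E, ‖u z.1‖ₑ * ‖u z.2‖ₑ * κ (z.2 - z.1) ∂((volume : Measure E).prod volume) ≤
      2 * ENNReal.ofReal (l^(1-p) * (C2 * m)) * J := by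
    have hue : ∀ x, ‖u x‖ₑ = ENNReal.ofReal (w x) * ‖ext g x‖ₑ := by
      intro x
      rw [hu]; simp only; rw [enorm_mul, ← ofReal_norm (w x : ℂ), Complex.norm_real, Real.norm_of_nonneg (hw0 x)]
    have hhalf : ∫⁻ x, ∫⁻ y, (‖ext g x‖ₑ^2 * ENNReal.ofReal (w x)) * (κ (y - x) * ENNReal.ofReal (w y)) ≤
        ENNReal.ofReal (l^(1-p) * (C2 * m)) * J := by
      rw [hJ, ← lintegral_const_mul' _ _ ENNReal.ofReal_ne_top]
      apply lintegral_mono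
      intro x
      show ∫⁻ y, (‖ext g x‖ₑ^2 * ENNReal.ofReal (w x)) * (κ (y - x) * ENNReal.ofReal (w y)) ≤ ENNReal.ofReal (l^(1-p) * (C2 * m)) * (‖ext g x‖ₑ^2 * ENNReal.ofReal (w x))
      rw [lintegral_const_mul' _ _ (by finiteness), mul_comm]
      exact mul_le_mul_left (hker x) _
    calc _ ≤ ∫⁻ z : E × E, ((‖ext g z.1‖ₑ^2 * ENNReal.ofReal (w z.1)) * (κ (z.2 - z.1) * ENNReal.ofReal (w z.2)) +
          (‖ext g z.2‖ₑ^2 * ENNReal.ofReal (w z.2)) * (κ (z.1 - z.2) * ENNReal.ofReal (w z.1))) ∂((volume : Measure E).prod volume) := by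
          apply lintegral_mono
          intro z
          have hs : κ (z.1 - z.2) = κ (z.2 - z.1) := by rw [← hκs, neg_sub]
          simp only [hue, hs]
          calc _ = (ENNReal.ofReal (w z.1) * ENNReal.ofReal (w z.2) * κ (z.2 - z.1)) * (‖ext g z.1‖ₑ * ‖ext g z.2‖ₑ) := by ring
            _ ≤ (ENNReal.ofReal (w z.1) * ENNReal.ofReal (w z.2) * κ (z.2 - z.1)) * (‖ext g z.1‖ₑ^2 + ‖ext g z.2‖ₑ^2) := by
              gcongr; exact enn_mul_le _ _
            _ = _ := by ring
      _ = (∫⁻ x, ∫⁻ y, (‖ext g x‖ₑ^2 * ENNReal.ofReal (w x)) * (κ (y - x) * ENNReal.ofReal (w y))) +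
          ∫⁻ y, ∫⁻ x, (‖ext g y‖ₑ^2 * ENNReal.ofReal (w y)) * (κ (x - y) * ENNReal.ofReal (w x)) := by
          rw [lintegral_add_left (by fun_prop), lintegral_prod _ (by fun_prop), lintegral_prod_symm _ (by fun_prop)]
      _ ≤ ENNReal.ofReal (l^(1-p) * (C2 * m)) * J + ENNReal.ofReal (l^(1-p) * (C2 * m)) * J := add_le_add hhalf hhalf
      _ = _ := by ring
  have hDJ : D ≤ ENNReal.ofReal ((2 * C1 + 2 * C2) * (R * l + l^(1-p) * m)) * J := by
    calc D ≤ _ := hD R hR u hui hu2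
      _ ≤ ENNReal.ofReal (C1 * R) * (ENNReal.ofReal (2 * l) * J) + 2 * ENNReal.ofReal (l^(1-p) * (C2 * m)) * J := by
          gcongr
      _ = ENNReal.ofReal (C1 * R * (2 * l) + 2 * (l^(1-p) * (C2 * m))) * J := by
          rw [ENNReal.ofReal_add (by positivity) (by positivity), ENNReal.ofReal_mul (p := C1 * R) (by positivity), ENNReal.ofReal_mul (p := 2) (q := l) (by positivity), ENNReal.ofReal_mul (p := 2) (q := l^(1-p) * (C2 * m)) (by positivity)]
          simp only [ENNReal.ofReal_ofNat]; ring
      _ ≤ _ := by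
          gcongr
          have q1 : 0 ≤ l^(1-p) * m := by positivity
          have q2 : 0 ≤ R * l := by positivity
          nlinarith [mul_nonneg hC1 q1, mul_nonneg hC2 q2]
  by_cases hJ0 : J = 0
  · rw [hJ0]; exact zero_le
  have hfinal : J * J ≤ (ENNReal.ofReal ((2 * C1 + 2 * C2) * (R * l + l^(1-p) * m)) * G) * J := by
    calc J * J = J^2 := by ring
      _ ≤ G * D := hCS
      _ ≤ G * (ENNReal.ofReal ((2 * C1 + 2 * C2) * (R * l + l^(1-p) * m)) * J) := by gcongr
      _ = _ := by ring
  exact (ENNReal.mul_le_mul_iff_left hJ0 hJfin).1 hfinal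
end sphere
end WL

namespace WL

section sphere
variable {E : Type*} [NormedAddCommGroup E] [InnerProductSpace ℝ E] [FiniteDimensional ℝ E]
  [MeasurableSpace E] [BorelSpace E] [Nontrivial E]

lemma level (hd : 3 ≤ Module.finrank ℝ E) (p : ℝ) (hp : ((Module.finrank ℝ E : ℝ) - 1)/2 < p) :
    ∃ C q : ℝ, 0 ≤ C ∧ 0 < q ∧ q < 1 ∧ ∀ w : E → ℝ, Measurable w → (∀ x, 0 ≤ w x) → FP p w → ∀ (k : ℤ) (M : ℝ),
      (∀ x, w x ≠ 0 → ‖x‖ < M ∧ (2:ℝ)^k ≤ w x ∧ w x ≤ 2 * (2:ℝ)^k) →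
      ∀ g : sphere (0:E) 1 → ℂ, Continuous g →
      ∫⁻ x, ‖ext g x‖ₑ^2 * ENNReal.ofReal (w x) ≤
      ENNReal.ofReal (C * q ^ k.natAbs) * ∫⁻ ω, ‖g ω‖ₑ^2 ∂(volume : Measure E).toSphere := by
  obtain ⟨C, hC, h⟩ := level0 hd p hp
  set d := Module.finrank ℝ E with hdd
  have hd3 : (3:ℝ) ≤ d := by exact_mod_cast hd
  set a : ℝ := ((d:ℝ) - 1)/2 with ha
  have ha1 : 1 ≤ a := by rw [ha]; linarith
  set s : ℝ := (p - a) / (2 * p - a) with hs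
  have hs0 : 0 < s := div_pos (by linarith) (by linarith)
  set q1 : ℝ := (2:ℝ)^(1-p) with hq1
  set q2 : ℝ := (2:ℝ)^(-s) with hq2
  have hq1l : q1 < 1 := Real.rpow_lt_one_of_one_lt_of_neg (by norm_num) (by linarith)
  have hq2l : q2 < 1 := Real.rpow_lt_one_of_one_lt_of_neg (by norm_num) (by linarith)
  have hq10 : 0 < q1 := by positivity
  have hq20 : 0 < q2 := by positivity
  refine ⟨C * 2, max q1 q2, by positivity, lt_max_of_lt_left hq10, max_lt hq1l hq2l, ?_⟩
  intro w hw hw0 hFP k M hsupp g hg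
  have hl : (0:ℝ) < 2^k := by positivity
  have key : ∃ R : ℝ, 0 < R ∧ R * (2:ℝ)^k + ((2:ℝ)^k) ^ (1 - p) * min 1 (R ^ (-(2 * p - a - 1))) ≤ 2 * (max q1 q2) ^ k.natAbs := by
    rcases le_total 0 k with hk | hk
    · obtain ⟨j, rfl⟩ := Int.eq_ofNat_of_zero_le hk
      have hj : ((2:ℝ)^(j:ℤ)) ^ (1-p) = q1 ^ j := by
        rw [hq1, zpow_natCast, ← Real.rpow_natCast, ← Real.rpow_mul (by norm_num), ← Real.rpow_natCast (_ ^ _), ← Real.rpow_mul (by norm_num), mul_comm]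
      refine ⟨((2:ℝ)^(j:ℤ)) ^ (-p), by positivity, ?_⟩
      have e1 : ((2:ℝ)^(j:ℤ)) ^ (-p) * (2:ℝ)^(j:ℤ) = q1 ^ j := by
        rw [← hj, sub_eq_add_neg, add_comm, Real.rpow_add hl, Real.rpow_one]
      rw [e1, hj]
      have e2 : q1^j ≤ (max q1 q2)^j := pow_le_pow_left₀ hq10.le (le_max_left _ _) _
      have e3 : q1^j * min 1 ((((2:ℝ)^(j:ℤ)) ^ (-p)) ^ (-(2 * p - a - 1))) ≤ q1^j * 1 :=
        mul_le_mul_of_nonneg_left (min_le_left _ _) (by positivity)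
      simp only [Int.natAbs_natCast]
      linarith
    · obtain ⟨j, hjk⟩ := Int.eq_ofNat_of_zero_le (show 0 ≤ -k by omega)
      obtain rfl : k = -(j:ℤ) := by omega
      have hj : ((2:ℝ)^(-(j:ℤ))) ^ s = q2 ^ j := by
        rw [hq2, zpow_neg, zpow_natCast, ← Real.rpow_natCast, ← Real.rpow_natCast, ← Real.rpow_neg (by norm_num), ← Real.rpow_mul (by norm_num), ← Real.rpow_mul (by norm_num)]
        congr 1; ring
      set l : ℝ := (2:ℝ)^(-(j:ℤ)) with hll
      obtain ⟨D, hD⟩ : ∃ D, D = 2 * p - a := ⟨_, rfl⟩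
      have hne : D ≠ 0 := by rw [hD]; intro hh; linarith
      have haD : a = 2 * p - D := by rw [hD]; ring
      refine ⟨l ^ (-p/D), by positivity, ?_⟩
      have e1 : l ^ (-p/D) * l = q2 ^ j := by
        rw [← hj]; nth_rw 2 [← Real.rpow_one l]; rw [← Real.rpow_add hl]
        congr 1; rw [hs, ← hD, haD]; field_simp; ring
      have e4 : l ^ (1-p) * (l ^ (-p/D)) ^ (-(2 * p - a - 1)) = q2 ^ j := by
        rw [← hj, ← Real.rpow_mul hl.le, ← Real.rpow_add hl]
        congr 1; rw [hs, ← hD, haD]; field_simp; ring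
      have e2 : q2^j ≤ (max q1 q2)^j := pow_le_pow_left₀ hq20.le (le_max_right _ _) _
      have e3 : l ^ (1-p) * min 1 ((l ^ (-p/D)) ^ (-(2 * p - a - 1))) ≤ l ^ (1-p) * (l ^ (-p/D)) ^ (-(2 * p - a - 1)) :=
        mul_le_mul_of_nonneg_left (min_le_right _ _) (by positivity)
      simp only [Int.natAbs_neg, Int.natAbs_natCast]
      linarith
  obtain ⟨R, hR, hb⟩ := key
  refine (h w hw hw0 hFP _ M hl hsupp R hR g hg).trans ?_
  gcongr ?_ * _
  apply ENNReal.ofReal_le_ofReal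
  rw [mul_assoc]
  exact mul_le_mul_of_nonneg_left hb hC

lemma FP.mono {p : ℝ} (hp : 0 < p) {w v : E → ℝ} (hw : FP p w) (h : ∀ x, 0 ≤ v x ∧ v x ≤ w x) : FP p v := by
  intro x r hr
  refine (lintegral_mono fun y => ?_).trans (hw x r hr)
  exact ENNReal.ofReal_le_ofReal (Real.rpow_le_rpow (h y).1 (h y).2 hp.le)

lemma core (hd : 3 ≤ Module.finrank ℝ E) (p : ℝ) (hp : ((Module.finrank ℝ E : ℝ) - 1)/2 < p) :
    ∃ C : ℝ, 0 ≤ C ∧ ∀ w : E → ℝ, Measurable w → (∀ x, 0 ≤ w x) → FP p w →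
      ∀ g : sphere (0:E) 1 → ℂ, Continuous g →
      ∫⁻ x, ‖ext g x‖ₑ^2 * ENNReal.ofReal (w x) ≤
      ENNReal.ofReal C * ∫⁻ ω, ‖g ω‖ₑ^2 ∂(volume : Measure E).toSphere := by
  obtain ⟨C, q, hC, hq0, hq1, h⟩ := level hd p hp
  have hd3 : (3:ℝ) ≤ Module.finrank ℝ E := by exact_mod_cast hd
  have hsum : Summable (fun k : ℤ => C * q ^ k.natAbs) := by
    apply Summable.mul_left
    apply Summable.of_nat_of_neg
    · simpa using summable_geometric_of_lt_one hq0.le hq1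
    · simpa using summable_geometric_of_lt_one hq0.le hq1
  refine ⟨∑' k : ℤ, C * q ^ k.natAbs, tsum_nonneg fun k => by positivity, ?_⟩
  intro w hw hw0 hFP g hg
  set G := ∫⁻ ω, ‖g ω‖ₑ^2 ∂(volume : Measure E).toSphere with hG
  set S : ℕ → ℤ → Set E := fun m k => ball 0 m ∩ {x | (2:ℝ)^k ≤ w x ∧ w x < 2^(k+1)} with hS
  have hSm : ∀ m k, MeasurableSet (S m k) := fun m k =>
    measurableSet_ball.inter (hw measurableSet_Ico)
  have hm := ext_meas g hg
  have hlev : ∀ (m : ℕ) (k : ℤ), ∫⁻ x in S m k, ‖ext g x‖ₑ^2 * ENNReal.ofReal (w x) ≤ ENNReal.ofReal (C * q ^ k.natAbs) * G := by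
    intro m k
    have := h ((S m k).indicator w) (hw.indicator (hSm m k)) (fun x => Set.indicator_nonneg (fun y _ => hw0 y) x)
      (hFP.mono (by linarith) fun x => ⟨Set.indicator_nonneg (fun y _ => hw0 y) x, Set.indicator_le_self' (fun _ _ => hw0 _) x⟩) k m ?_ g hg
    · refine le_trans (le_of_eq ?_) this
      rw [← lintegral_indicator (hSm m k)]
      congr 1; ext x
      by_cases hx : x ∈ S m k <;> simp [hx]
    · intro x hx
      have hx : x ∈ S m k := by
        by_contra hh; simp [hh] at hx
      rw [Set.indicator_of_mem hx]
      have h2 : w x < 2^(k+1) := hx.2.2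
      rw [zpow_add_one₀ (by norm_num)] at h2
      refine ⟨by simpa using hx.1, hx.2.1, by linarith⟩
  have hball : ∀ m : ℕ, ∫⁻ x in ball 0 (m:ℝ), ‖ext g x‖ₑ^2 * ENNReal.ofReal (w x) ≤ ENNReal.ofReal (∑' k : ℤ, C * q ^ k.natAbs) * G := by
    intro m
    have hcov : ball (0:E) (m:ℝ) ⊆ {x | w x = 0} ∪ ⋃ k, S m k := by
      intro x hx
      by_cases h0 : w x = 0
      · left; exact h0
      · right
        obtain ⟨k, hk⟩ := exists_mem_Ico_zpow (x := w x) (y := 2) (lt_of_le_of_ne (hw0 x) (Ne.symm h0)) (by norm_num)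
        exact Set.mem_iUnion.2 ⟨k, hx, hk.1, hk.2⟩
    have hz : ∫⁻ x in {x | w x = 0}, ‖ext g x‖ₑ^2 * ENNReal.ofReal (w x) = 0 := by
      rw [setLIntegral_congr_fun (g := fun _ => 0) (measurableSet_eq_fun hw measurable_const) ?_]
      · simp
      · intro x hx
        have hx : w x = 0 := hx
        simp [hx]
    calc _ ≤ ∫⁻ x in {x | w x = 0} ∪ ⋃ k, S m k, ‖ext g x‖ₑ^2 * ENNReal.ofReal (w x) := lintegral_mono_set hcov
      _ ≤ (∫⁻ x in {x | w x = 0}, ‖ext g x‖ₑ^2 * ENNReal.ofReal (w x)) + ∫⁻ x in ⋃ k, S m k, ‖ext g x‖ₑ^2 * ENNReal.ofReal (w x) := lintegral_union_le _ _ _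
      _ ≤ 0 + ∑' k : ℤ, ∫⁻ x in S m k, ‖ext g x‖ₑ^2 * ENNReal.ofReal (w x) := add_le_add hz.le (lintegral_iUnion_le _ _)
      _ ≤ ∑' k : ℤ, ENNReal.ofReal (C * q ^ k.natAbs) * G := by
          rw [zero_add]; exact ENNReal.tsum_le_tsum (hlev m)
      _ = _ := by
          rw [ENNReal.tsum_mul_right, ENNReal.ofReal_tsum_of_nonneg (fun k => by positivity) hsum]
  have hU : (⋃ m : ℕ, ball (0:E) (m:ℝ)) = Set.univ := iUnion_ball_nat 0
  rw [← setLIntegral_univ, ← hU, setLIntegral_iUnion_of_directed]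
  · exact iSup_le hball
  · exact (monotone_nat_of_le_succ fun m => ball_subset_ball (by push_cast; linarith)).directed_le
end sphere
end WL

namespace WL

section sphere
variable {E : Type*} [NormedAddCommGroup E] [InnerProductSpace ℝ E] [FiniteDimensional ℝ E]
  [MeasurableSpace E] [BorelSpace E] [Nontrivial E]

lemma scaled (hd : 3 ≤ Module.finrank ℝ E) (p : ℝ) (hp : ((Module.finrank ℝ E : ℝ) - 1)/2 < p) :
    ∃ C : ℝ, 0 ≤ C ∧ ∀ (W : E → ℝ) (N : ℝ), Measurable W → (∀ x, 0 ≤ W x) → 0 < N →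
      (∀ (x : E) (r : ℝ), 0 < r → ∫⁻ y in ball x r, ENNReal.ofReal (W y ^ p) ≤
        ENNReal.ofReal (N ^ p * r ^ ((Module.finrank ℝ E : ℝ) - 2 * p))) →
      ∀ ρ : ℝ, 0 < ρ → ∀ g : sphere (0:E) 1 → ℂ, Continuous g →
      ∫⁻ x, ‖ext g (ρ • x)‖ₑ^2 * ENNReal.ofReal (W x) ≤
      ENNReal.ofReal (C * N * (ρ ^ 2 * (ρ ^ Module.finrank ℝ E)⁻¹)) * ∫⁻ ω, ‖g ω‖ₑ^2 ∂(volume : Measure E).toSphere := by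
  obtain ⟨C, hC, h⟩ := core hd p hp
  refine ⟨C, hC, ?_⟩
  intro W N hW hW0 hN hWN ρ hρ g hg
  set d := Module.finrank ℝ E with hdd
  have hm := ext_meas g hg
  set w : E → ℝ := fun y => W (ρ⁻¹ • y) / (ρ^2 * N) with hw
  have hwm : Measurable w := by fun_prop
  have hw0 : ∀ x, 0 ≤ w x := fun x => div_nonneg (hW0 _) (by positivity)
  have hws : ∀ z, w (ρ • z) = W z / (ρ^2 * N) := by
    intro z; simp only [hw]; rw [inv_smul_smul₀ hρ.ne']
  have hFP : FP p w := by
    intro x r hr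
    set H : E → ℝ≥0∞ := (ball x r).indicator fun y => ENNReal.ofReal (w y ^ p) with hH
    have hHm : Measurable H := Measurable.indicator (by fun_prop) measurableSet_ball
    have h1 := lint_smul H hHm ρ hρ
    have h2 : ∀ z, H (ρ • z) = (ball (ρ⁻¹ • x) (r / ρ)).indicator (fun z => ENNReal.ofReal ((ρ^2 * N) ^ (-p)) * ENNReal.ofReal (W z ^ p)) z := by
      intro z
      have hiff : ρ • z ∈ ball x r ↔ z ∈ ball (ρ⁻¹ • x) (r / ρ) := by
        rw [mem_ball, mem_ball, dist_eq_norm, dist_eq_norm, lt_div_iff₀ hρ]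
        have : ρ • z - x = ρ • (z - ρ⁻¹ • x) := by rw [smul_sub, smul_inv_smul₀ hρ.ne']
        rw [this, norm_smul, Real.norm_of_nonneg hρ.le, mul_comm]
      by_cases hz : z ∈ ball (ρ⁻¹ • x) (r / ρ)
      · rw [Set.indicator_of_mem hz, hH, Set.indicator_of_mem (hiff.2 hz), hws, ← ENNReal.ofReal_mul (by positivity),
          Real.div_rpow (hW0 z) (by positivity), Real.rpow_neg (by positivity)]
        congr 1; rw [div_eq_mul_inv, mul_comm]
      · rw [Set.indicator_of_notMem hz, hH, Set.indicator_of_notMem (fun h => hz (hiff.1 h))]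
    simp_rw [h2] at h1
    rw [lintegral_indicator measurableSet_ball, lintegral_const_mul' _ _ ENNReal.ofReal_ne_top] at h1
    have h3 : ∫⁻ y in ball x r, ENNReal.ofReal (w y ^ p) = ENNReal.ofReal (ρ^d) * (ENNReal.ofReal ((ρ^d)⁻¹) * ∫⁻ x, H x) := by
      rw [← mul_assoc, ← ENNReal.ofReal_mul (by positivity), mul_inv_cancel₀ (by positivity), ENNReal.ofReal_one, one_mul, hH,
        lintegral_indicator measurableSet_ball]
    rw [h3, ← h1]
    calc _ ≤ ENNReal.ofReal (ρ^d) * (ENNReal.ofReal ((ρ^2 * N) ^ (-p)) * ENNReal.ofReal (N ^ p * (r/ρ) ^ ((d : ℝ) - 2 * p))) := by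
          gcongr; exact hWN _ _ (by positivity)
      _ = _ := by
          rw [← ENNReal.ofReal_mul (by positivity), ← ENNReal.ofReal_mul (by positivity)]
          congr 1
          rw [Real.mul_rpow (by positivity) hN.le, Real.rpow_neg hN.le, Real.div_rpow hr.le hρ.le, ← Real.rpow_natCast ρ 2,
            ← Real.rpow_mul hρ.le, ← Real.rpow_natCast ρ d, Real.rpow_sub hρ]
          have e1 : ρ ^ (((2:ℕ):ℝ) * -p) = (ρ ^ (2 * p))⁻¹ := by
            rw [← Real.rpow_neg hρ.le]; congr 1; push_cast; ring
          rw [e1]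
          have a1 : ρ ^ (2*p) ≠ 0 := by positivity
          have a2 : ρ ^ (d:ℝ) ≠ 0 := by positivity
          have a3 : N ^ p ≠ 0 := by positivity
          generalize ρ ^ (2*p) = A1 at *
          generalize ρ ^ (d:ℝ) = A2 at *
          generalize N ^ p = A3 at *
          field_simp
          rfl
  have h4 := h w hwm hw0 hFP g hg
  have h5 := lint_smul (fun y => ‖ext g y‖ₑ^2 * ENNReal.ofReal (w y)) (by fun_prop) ρ hρ
  simp only [hws] at h5
  have h6 : ∀ x, ‖ext g (ρ • x)‖ₑ^2 * ENNReal.ofReal (W x) = ENNReal.ofReal (ρ^2 * N) * (‖ext g (ρ • x)‖ₑ^2 * ENNReal.ofReal (W x / (ρ^2 * N))) := by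
    intro x
    rw [mul_left_comm, ← ENNReal.ofReal_mul (by positivity), mul_div_cancel₀ _ (by positivity)]
  simp_rw [h6]
  rw [lintegral_const_mul' _ _ ENNReal.ofReal_ne_top, h5]
  calc _ ≤ ENNReal.ofReal (ρ^2 * N) * (ENNReal.ofReal ((ρ^d)⁻¹) * (ENNReal.ofReal C * ∫⁻ ω, ‖g ω‖ₑ^2 ∂(volume : Measure E).toSphere)) := by
        gcongr
    _ = _ := by
        rw [← mul_assoc, ← mul_assoc, ← ENNReal.ofReal_mul (by positivity), ← ENNReal.ofReal_mul (by positivity)]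
        congr 2; ring

/-- 1-D Plancherel for the cosine transform -/
lemma cos_planch (G : ℝ → ℂ) (hG : Integrable G (volume.restrict (Set.Ioi 0))) :
    ∫⁻ t : ℝ, ‖∫ ρ in Set.Ioi (0:ℝ), (Real.cos (t * ρ) : ℂ) * G ρ‖ₑ^2 ≤
      ENNReal.ofReal (12 * Real.pi) * ∫⁻ ρ in Set.Ioi (0:ℝ), ‖G ρ‖ₑ^2 := by
  by_cases htop : ∫⁻ ρ in Set.Ioi (0:ℝ), ‖G ρ‖ₑ^2 = ⊤
  · rw [htop, ENNReal.mul_top (by simp [Real.pi_pos])]; exact le_top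
  set H : ℝ → ℂ := (Set.Ioi 0).indicator G with hH
  have hHi : Integrable H := (integrable_indicator_iff measurableSet_Ioi).2 hG
  have hHl : ∫⁻ ρ, ‖H ρ‖ₑ^2 = ∫⁻ ρ in Set.Ioi (0:ℝ), ‖G ρ‖ₑ^2 := by
    rw [← lintegral_indicator measurableSet_Ioi]
    congr 1; ext ρ
    by_cases hr : ρ ∈ Set.Ioi (0:ℝ)
    · simp only [hH, Set.indicator_of_mem hr]
    · simp [hH, Set.indicator_of_notMem hr]
  have hH2 : MemLp H 2 volume := by
    refine ⟨hHi.1, ?_⟩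
    rw [lt_top_iff_ne_top]
    intro h
    have := lint_eq_eLp H
    rw [h, hHl] at this
    exact htop (by rw [this]; simp)
  have hpl := planch_lint H hHi hH2
  have hcont := four_cont H hHi
  have hF : ∀ s : ℝ, 𝓕 H s = ∫ ρ in Set.Ioi (0:ℝ), cexp (-(2 * Real.pi * s * ρ : ℝ) * I) * G ρ := by
    intro s
    rw [Real.fourier_eq', ← integral_indicator measurableSet_Ioi]
    congr 1; ext ρ
    by_cases hr : ρ ∈ Set.Ioi (0:ℝ)
    · simp only [hH, Set.indicator_of_mem hr, smul_eq_mul]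
      congr 2; simp; ring
    · simp [hH, Set.indicator_of_notMem hr]
  have hci : ∀ c : ℝ, Integrable (fun ρ : ℝ => cexp (-(2 * Real.pi * c * ρ : ℝ) * I) * G ρ) (volume.restrict (Set.Ioi 0)) := by
    intro c
    refine hG.bdd_mul (c := 1) (Measurable.aestronglyMeasurable (by fun_prop)) (Filter.Eventually.of_forall fun ρ => ?_)
    rw [Complex.norm_exp]; simp
  have hsplit : ∀ t : ℝ, ∫ ρ in Set.Ioi (0:ℝ), (Real.cos (t * ρ) : ℂ) * G ρ =
      (1/2 : ℂ) * (𝓕 H ((2 * Real.pi)⁻¹ • t) + 𝓕 H (-((2 * Real.pi)⁻¹ • t))) := by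
    intro t
    rw [hF, hF, ← integral_add (hci _) (hci _), ← integral_const_mul]
    congr 1; ext ρ
    have hpi : (Real.pi : ℂ) ≠ 0 := by exact_mod_cast Real.pi_ne_zero
    have e1 : (-((2 * Real.pi * ((2 * Real.pi)⁻¹ • t) * ρ : ℝ):ℂ) * I) = -((t * ρ : ℝ):ℂ) * I := by
      congr 2; norm_cast; rw [smul_eq_mul]; field_simp
    have e2 : (-((2 * Real.pi * (-((2 * Real.pi)⁻¹ • t)) * ρ : ℝ):ℂ) * I) = ((t * ρ : ℝ):ℂ) * I := by
      congr 1; norm_cast; rw [smul_eq_mul]; field_simp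
    rw [e1, e2, Complex.ofReal_cos, Complex.cos]
    ring
  have hb : ∀ a b : ℂ, ‖(1/2:ℂ) * (a + b)‖ₑ^2 ≤ 3 * (‖a‖ₑ^2 + ‖b‖ₑ^2) := by
    intro a b
    have h1 : ‖(1/2:ℂ) * (a + b)‖ₑ ≤ ‖a‖ₑ + ‖b‖ₑ := by
      rw [enorm_mul]
      calc _ ≤ 1 * ‖a + b‖ₑ := by
            gcongr
            rw [← ofReal_norm]; norm_num
        _ ≤ _ := by rw [one_mul]; exact enorm_add_le _ _
    calc _ ≤ (‖a‖ₑ + ‖b‖ₑ)^2 := by gcongr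
      _ = ‖a‖ₑ^2 + ‖b‖ₑ^2 + 2 * (‖a‖ₑ * ‖b‖ₑ) := by ring
      _ ≤ ‖a‖ₑ^2 + ‖b‖ₑ^2 + 2 * (‖a‖ₑ^2 + ‖b‖ₑ^2) := by
        gcongr; exact enn_mul_le _ _
      _ = _ := by ring
  have hFm := hcont.measurable
  have hm1 : Measurable (fun s : ℝ => ‖𝓕 H (-s)‖ₑ^2) := by
    have := (hFm.comp measurable_neg).enorm.pow_const 2
    exact this
  have hm2 : Measurable (fun s : ℝ => ‖𝓕 H ((2 * Real.pi)⁻¹ • s)‖ₑ^2) := by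
    have := (hFm.comp (measurable_const_smul (2 * Real.pi)⁻¹)).enorm.pow_const 2
    exact this
  have hsc := lint_smul (fun s : ℝ => ‖𝓕 H s‖ₑ^2) (by fun_prop) (2 * Real.pi)⁻¹ (by positivity)
  have hsc2 := lint_smul (fun s : ℝ => ‖𝓕 H (-s)‖ₑ^2) hm1 (2 * Real.pi)⁻¹ (by positivity)
  rw [lintegral_neg_eq_self (fun s : ℝ => ‖𝓕 H s‖ₑ^2)] at hsc2
  rw [hpl, hHl] at hsc hsc2
  simp_rw [hsplit]
  calc _ ≤ ∫⁻ t : ℝ, 3 * (‖𝓕 H ((2 * Real.pi)⁻¹ • t)‖ₑ^2 + ‖𝓕 H (-((2 * Real.pi)⁻¹ • t))‖ₑ^2) := lintegral_mono fun t => hb _ _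
    _ = _ := by
      rw [lintegral_const_mul' _ _ (by simp), lintegral_add_left hm2, hsc, hsc2]
      rw [← two_mul, ← mul_assoc, ← mul_assoc]
      congr 1
      simp only [Module.finrank_self, pow_one, inv_inv]
      rw [show (12 * Real.pi) = 3 * 2 * (2 * Real.pi) by ring, ENNReal.ofReal_mul (p := 3*2) (by norm_num), ENNReal.ofReal_mul (p := 3) (q := 2) (by norm_num)]
      simp
end sphere
end WL

namespace WL

section sphere
variable {E : Type*} [NormedAddCommGroup E] [InnerProductSpace ℝ E] [FiniteDimensional ℝ E]
  [MeasurableSpace E] [BorelSpace E] [Nontrivial E]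

def Gx (F : E → ℂ) (x : E) (ρ : ℝ) : ℂ :=
  ((ρ ^ (Module.finrank ℝ E - 1) : ℝ) : ℂ) * ext (fun ω : sphere (0:E) 1 => F (ρ • (ω:E))) (ρ • x)

lemma Gx_meas (F : E → ℂ) (hF : Continuous F) : Measurable (fun q : E × ℝ => Gx F q.1 q.2) := by
  have hFm := hF.measurable
  unfold Gx
  apply Measurable.mul (by fun_prop)
  apply StronglyMeasurable.measurable
  unfold ext
  apply StronglyMeasurable.integral_prod_right' (f := fun q : (E × ℝ) × sphere (0:E) 1 =>
    cexp (2 * Real.pi * ⟪q.1.2 • q.1.1, (q.2:E)⟫ * I) * F (q.1.2 • (q.2:E)))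
  apply Measurable.stronglyMeasurable
  fun_prop

lemma wave_polar (F : E → ℂ) (hF : Continuous F) (hFi : Integrable F) (m : ℝ → ℂ) (hm : Measurable m) (hm1 : ∀ r, ‖m r‖ ≤ 1) (x : E) :
    𝓕⁻ (fun ξ => m ‖ξ‖ * F ξ) x = ∫ ρ in Set.Ioi (0:ℝ), m ρ * Gx F x ρ ∧
    Integrable (fun ρ => m ρ * Gx F x ρ) (volume.restrict (Set.Ioi 0)) := by
  set f : E → ℂ := fun ξ => cexp (2 * Real.pi * ⟪ξ, x⟫ * I) * (m ‖ξ‖ * F ξ) with hf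
  have hFm := hF.measurable
  have hfm : Measurable f := by fun_prop
  have hfi : Integrable f := by
    refine hFi.mono hfm.aestronglyMeasurable (Filter.Eventually.of_forall fun ξ => ?_)
    rw [hf]; simp only
    rw [norm_mul, norm_e, one_mul, norm_mul]
    exact mul_le_of_le_one_left (norm_nonneg _) (hm1 _)
  have h1 : 𝓕⁻ (fun ξ => m ‖ξ‖ * F ξ) x = ∫ ξ, f ξ := by
    rw [Real.fourierInv_eq']
    congr 1; ext ξ
    rw [hf]; simp only [smul_eq_mul]
    congr 2; push_cast; ring
  have hpi := polar_integrable volume f hfi hfm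
  have hcongr : ∀ ρ ∈ Set.Ioi (0:ℝ), ∫ ω : sphere (0:E) 1, ((ρ ^ (Module.finrank ℝ E - 1) : ℝ) : ℂ) * f (ρ • (ω:E)) ∂(volume : Measure E).toSphere
      = m ρ * Gx F x ρ := by
    intro ρ hρ
    have hρ : 0 < ρ := hρ
    unfold Gx ext
    rw [← integral_const_mul, ← integral_const_mul]
    congr 1; ext ω
    rw [hf]; simp only
    have hn : ‖ρ • (ω:E)‖ = ρ := by rw [norm_smul, norm_eq_of_mem_sphere, mul_one, Real.norm_of_nonneg hρ.le]
    have hin : ⟪ρ • (ω:E), x⟫ = ⟪ρ • x, (ω:E)⟫ := by rw [real_inner_smul_left, real_inner_smul_left, real_inner_comm]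
    rw [hn, hin]; ring
  constructor
  · rw [h1, polar_int volume f hfi hfm, integral_prod_symm _ hpi]
    exact setIntegral_congr_fun measurableSet_Ioi hcongr
  · refine hpi.integral_prod_right.congr ?_
    filter_upwards [ae_restrict_mem measurableSet_Ioi] with ρ hρ
    exact hcongr ρ hρ

lemma wave (hd : 3 ≤ Module.finrank ℝ E) (p : ℝ) (hp : ((Module.finrank ℝ E : ℝ) - 1)/2 < p) :
    ∃ C : ℝ, 0 ≤ C ∧ ∀ (W : E → ℝ) (N : ℝ), Measurable W → (∀ x, 0 ≤ W x) → 0 < N →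
      (∀ (x : E) (r : ℝ), 0 < r → ∫⁻ y in ball x r, ENNReal.ofReal (W y ^ p) ≤
        ENNReal.ofReal (N ^ p * r ^ ((Module.finrank ℝ E : ℝ) - 2 * p))) →
      ∀ F : E → ℂ, Continuous F → Integrable F →
      ∫⁻ t : ℝ, ∫⁻ x, ‖𝓕⁻ (fun ξ => (Real.cos (t * ‖ξ‖) : ℂ) * F ξ) x‖ₑ^2 * ENNReal.ofReal (W x) ≤
      ENNReal.ofReal (C * N) * ∫⁻ ξ, ENNReal.ofReal ‖ξ‖ * ‖F ξ‖ₑ^2 := by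
  obtain ⟨C, hC, h⟩ := scaled hd p hp
  refine ⟨12 * Real.pi * C, by positivity, ?_⟩
  intro W N hW hW0 hN hWN F hF hFi
  have hFm := hF.measurable
  have hGm := Gx_meas F hF
  set d := Module.finrank ℝ E with hdd
  have hcos : ∀ t : ℝ, ∀ x, 𝓕⁻ (fun ξ => (Real.cos (t * ‖ξ‖) : ℂ) * F ξ) x = ∫ ρ in Set.Ioi (0:ℝ), (Real.cos (t * ρ) : ℂ) * Gx F x ρ := by
    intro t x
    exact (wave_polar F hF hFi (fun ρ => (Real.cos (t * ρ) : ℂ)) (by fun_prop) (fun r => by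
      rw [Complex.norm_real]; exact Real.abs_cos_le_one _) x).1
  have hGi : ∀ x, Integrable (Gx F x) (volume.restrict (Set.Ioi 0)) := by
    intro x
    have := (wave_polar F hF hFi (fun _ => 1) (by fun_prop) (by simp) x).2
    simpa using this
  simp_rw [hcos]
  have hum : Measurable (fun q : ℝ × E => ∫ ρ in Set.Ioi (0:ℝ), (Real.cos (q.1 * ρ) : ℂ) * Gx F q.2 ρ) := by
    apply StronglyMeasurable.measurable
    apply StronglyMeasurable.integral_prod_right' (f := fun z : (ℝ × E) × ℝ => (Real.cos (z.1.1 * z.2) : ℂ) * Gx F z.1.2 z.2)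
    apply Measurable.stronglyMeasurable
    have : Measurable (fun z : (ℝ × E) × ℝ => Gx F z.1.2 z.2) := hGm.comp (by fun_prop : Measurable (fun z : (ℝ × E) × ℝ => (z.1.2, z.2)))
    fun_prop
  rw [lintegral_lintegral_swap (by
    apply Measurable.aemeasurable
    exact (hum.enorm.pow_const 2).mul (by fun_prop))]
  have step1 : ∀ x, ∫⁻ t : ℝ, ‖∫ ρ in Set.Ioi (0:ℝ), (Real.cos (t * ρ) : ℂ) * Gx F x ρ‖ₑ^2 * ENNReal.ofReal (W x) ≤
      ENNReal.ofReal (12 * Real.pi) * ∫⁻ ρ in Set.Ioi (0:ℝ), ‖Gx F x ρ‖ₑ^2 * ENNReal.ofReal (W x) := by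
    intro x
    rw [lintegral_mul_const' _ _ ENNReal.ofReal_ne_top, lintegral_mul_const' _ _ ENNReal.ofReal_ne_top, ← mul_assoc]
    exact mul_le_mul_left (cos_planch _ (hGi x)) _
  refine (lintegral_mono step1).trans ?_
  rw [lintegral_const_mul' _ _ ENNReal.ofReal_ne_top]
  rw [lintegral_lintegral_swap (by
    apply Measurable.aemeasurable
    exact (hGm.enorm.pow_const 2).mul (by fun_prop))]
  have step2 : ∀ ρ ∈ Set.Ioi (0:ℝ), ∫⁻ x, ‖Gx F x ρ‖ₑ^2 * ENNReal.ofReal (W x) ≤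
      ENNReal.ofReal (C * N) * (ENNReal.ofReal (ρ ^ (d - 1)) * ∫⁻ ω : sphere (0:E) 1, ENNReal.ofReal ‖ρ • (ω:E)‖ * ‖F (ρ • (ω:E))‖ₑ^2 ∂(volume : Measure E).toSphere) := by
    intro ρ hρ
    have hρ : 0 < ρ := hρ
    have hn : ∀ ω : sphere (0:E) 1, ‖ρ • (ω:E)‖ = ρ := fun ω => by rw [norm_smul, norm_eq_of_mem_sphere, mul_one, Real.norm_of_nonneg hρ.le]
    simp_rw [hn]
    rw [lintegral_const_mul' _ _ ENNReal.ofReal_ne_top]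
    have e1 : ∀ x, ‖Gx F x ρ‖ₑ^2 * ENNReal.ofReal (W x) = ENNReal.ofReal ((ρ^(d-1))^2) *
        (‖ext (fun ω : sphere (0:E) 1 => F (ρ • (ω:E))) (ρ • x)‖ₑ^2 * ENNReal.ofReal (W x)) := by
      intro x
      unfold Gx
      rw [enorm_mul, ← ofReal_norm ((_ : ℝ) : ℂ), Complex.norm_real, Real.norm_of_nonneg (by positivity), mul_pow, mul_assoc, ENNReal.ofReal_pow (p := ρ^(d-1)) (by positivity)]
    simp_rw [e1]
    rw [lintegral_const_mul' _ _ ENNReal.ofReal_ne_top]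
    refine (mul_le_mul_right (h W N hW hW0 hN hWN ρ hρ (fun ω => F (ρ • (ω:E))) (by fun_prop)) _).trans (le_of_eq ?_)
    simp only [← mul_assoc]
    rw [← ENNReal.ofReal_mul (by positivity), ← ENNReal.ofReal_mul (by positivity), ← ENNReal.ofReal_mul (by positivity)]
    congr 2
    obtain ⟨k, hk⟩ : ∃ k, d = k + 1 := ⟨d - 1, by omega⟩
    rw [hk]; simp only [Nat.add_sub_cancel]
    field_simp
    ring
  calc _ ≤ ENNReal.ofReal (12 * Real.pi) * ∫⁻ ρ in Set.Ioi (0:ℝ), ENNReal.ofReal (C * N) * (ENNReal.ofReal (ρ ^ (d - 1)) * ∫⁻ ω : sphere (0:E) 1, ENNReal.ofReal ‖ρ • (ω:E)‖ * ‖F (ρ • (ω:E))‖ₑ^2 ∂(volume : Measure E).toSphere) := by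
        exact mul_le_mul_right (setLIntegral_mono' measurableSet_Ioi step2) _
    _ = _ := by
        rw [lintegral_const_mul' _ _ ENNReal.ofReal_ne_top, polar_lint volume (fun ξ => ENNReal.ofReal ‖ξ‖ * ‖F ξ‖ₑ^2) (by fun_prop), ← mul_assoc, ← ENNReal.ofReal_mul (by positivity)]
        congr 2; ring
end sphere
end WL
namespace WL

lemma fp_conv (n : ℕ) (p : ℝ) (hp : 0 < p) (V : EuclideanSpace ℝ (Fin n) → ℂ) (N : ℝ) (hN : 0 < N)
    (h : fpNorm n p V ≤ ENNReal.ofReal N) (x : EuclideanSpace ℝ (Fin n)) (r : ℝ) (hr : 0 < r) :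
    ∫⁻ y in ball x r, ENNReal.ofReal (‖V y‖ ^ p) ≤ ENNReal.ofReal (N ^ p * r ^ ((n:ℝ) - 2 * p)) := by
  have h1 : ENNReal.ofReal (r ^ (2 - n / p)) *
      (∫⁻ y in ball x r, ENNReal.ofReal (‖V y‖ ^ p)) ^ (1 / p) ≤ ENNReal.ofReal N := by
    refine le_trans ?_ h
    unfold fpNorm
    exact le_iSup_of_le x (le_iSup_of_le r (le_iSup_of_le hr le_rfl))
  set J := ∫⁻ y in ball x r, ENNReal.ofReal (‖V y‖ ^ p) with hJ
  have h2 := ENNReal.rpow_le_rpow h1 hp.le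
  rw [ENNReal.mul_rpow_of_nonneg _ _ hp.le, ← ENNReal.rpow_mul, one_div, inv_mul_cancel₀ hp.ne', ENNReal.rpow_one,
    ENNReal.ofReal_rpow_of_pos (by positivity), ENNReal.ofReal_rpow_of_pos hN, ← Real.rpow_mul hr.le] at h2
  have e : (2 - n / p) * p = -((n:ℝ) - 2 * p) := by field_simp; ring
  rw [e] at h2
  calc J = ENNReal.ofReal (r ^ ((n:ℝ) - 2 * p)) * (ENNReal.ofReal (r ^ (-((n:ℝ) - 2 * p))) * J) := by
        rw [← mul_assoc, ← ENNReal.ofReal_mul (by positivity), ← Real.rpow_add hr, add_neg_cancel, Real.rpow_zero, ENNReal.ofReal_one, one_mul]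
    _ ≤ ENNReal.ofReal (r ^ ((n:ℝ) - 2 * p)) * ENNReal.ofReal (N ^ p) := by gcongr
    _ = _ := by rw [← ENNReal.ofReal_mul (by positivity), mul_comm]

lemma rhs_eq (n : ℕ) (f : 𝓢(EuclideanSpace ℝ (Fin n), ℂ)) :
    ∫⁻ ξ, ENNReal.ofReal ‖ξ‖ * ‖𝓕 (⇑f) ξ‖ₑ^2 = eLpNorm (mOp n (powMult (1 / 2)) (⇑f)) 2 volume ^ 2 ∧
    ∫⁻ ξ, ENNReal.ofReal ‖ξ‖ * ‖𝓕 (⇑f) ξ‖ₑ^2 ≠ ⊤ := by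
  set F : 𝓢(EuclideanSpace ℝ (Fin n), ℂ) := 𝓕 f with hF
  have hFf : 𝓕 (⇑f) = ⇑F := (SchwartzMap.fourier_coe f).symm
  unfold mOp powMult
  rw [hFf]
  set h : EuclideanSpace ℝ (Fin n) → ℂ := fun ξ => ((‖ξ‖ ^ ((1:ℝ)/2) : ℝ) : ℂ) * F ξ with hh
  have hFc := F.continuous
  have hhm : Continuous h := by
    have : Continuous (fun ξ : EuclideanSpace ℝ (Fin n) => ‖ξ‖ ^ ((1:ℝ)/2)) := continuous_norm.rpow_const (fun _ => Or.inr (by norm_num))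
    fun_prop
  have hhe : ∀ ξ, ‖h ξ‖ₑ^2 = ENNReal.ofReal ‖ξ‖ * ‖F ξ‖ₑ^2 := by
    intro ξ
    rw [hh]; simp only
    rw [enorm_mul, ← ofReal_norm ((_ : ℝ) : ℂ), Complex.norm_real, Real.norm_of_nonneg (by positivity), mul_pow,
      ← ENNReal.ofReal_pow (by positivity), ← Real.rpow_natCast, ← Real.rpow_mul (norm_nonneg _)]
    norm_num
  have hi1 := F.integrable_pow_mul volume 1
  have hhi : Integrable h := by
    refine (F.integrable.norm.add hi1).mono' hhm.aestronglyMeasurable (Filter.Eventually.of_forall fun ξ => ?_)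
    rw [hh]; simp only [Pi.add_apply, pow_one]
    rw [norm_mul, Complex.norm_real, Real.norm_of_nonneg (by positivity)]
    have : ‖ξ‖ ^ ((1:ℝ)/2) ≤ 1 + ‖ξ‖ := by
      rcases le_total ‖ξ‖ 1 with h1 | h1
      · have := Real.rpow_le_one (norm_nonneg ξ) h1 (z := 1/2) (by norm_num)
        linarith [norm_nonneg ξ]
      · have := Real.rpow_le_rpow_of_exponent_le h1 (y := 1/2) (z := 1) (by norm_num)
        rw [Real.rpow_one] at this; linarith
    nlinarith [norm_nonneg (F ξ)]
  have hS : ∫⁻ ξ, ENNReal.ofReal ‖ξ‖ * ‖F ξ‖ₑ^2 ≠ ⊤ := by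
    set B := SchwartzMap.seminorm ℝ 0 0 F with hB
    have hB1 : ∀ ξ, ‖F ξ‖ ≤ B := fun ξ => F.norm_le_seminorm ℝ ξ
    have hfin := hi1.2
    rw [hasFiniteIntegral_iff_enorm] at hfin
    have : ∫⁻ ξ, ENNReal.ofReal ‖ξ‖ * ‖F ξ‖ₑ^2 ≤ ENNReal.ofReal B * ∫⁻ ξ, ‖‖ξ‖^1 * ‖F ξ‖‖ₑ := by
      rw [← lintegral_const_mul' _ _ ENNReal.ofReal_ne_top]
      apply lintegral_mono
      intro ξ
      have e1 : ‖‖ξ‖^1 * ‖F ξ‖‖ₑ = ENNReal.ofReal ‖ξ‖ * ‖F ξ‖ₑ := by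
        rw [pow_one, enorm_mul, enorm_norm, enorm_norm, ofReal_norm]
      simp only [e1]
      have e2 : ‖F ξ‖ₑ ≤ ENNReal.ofReal B := by rw [← ofReal_norm]; exact ENNReal.ofReal_le_ofReal (hB1 ξ)
      calc ENNReal.ofReal ‖ξ‖ * ‖F ξ‖ₑ^2 = ‖F ξ‖ₑ * (ENNReal.ofReal ‖ξ‖ * ‖F ξ‖ₑ) := by ring
        _ ≤ _ := by gcongr
    exact (this.trans_lt (ENNReal.mul_lt_top ENNReal.ofReal_lt_top hfin)).ne
  have hl : ∫⁻ ξ, ‖h ξ‖ₑ^2 = ∫⁻ ξ, ENNReal.ofReal ‖ξ‖ * ‖F ξ‖ₑ^2 := lintegral_congr hhe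
  have h2 : MemLp h 2 volume := by
    refine ⟨hhm.aestronglyMeasurable, ?_⟩
    rw [lt_top_iff_ne_top]
    intro ht
    have := lint_eq_eLp h
    rw [ht, hl] at this
    exact hS (by rw [this]; simp)
  refine ⟨?_, hS⟩
  rw [← hl, lint_eq_eLp, ← planch_inv h hhi h2]

end WL

end WLsec

/-- Weighted space-time `L²` estimate for `cos(t√−Δ)`. -/
theorem weighted_L2_cos (n : ℕ) (hn : 3 ≤ n) (p : ℝ) (hp : ((n : ℝ) - 1) / 2 < p) :
    ∃ C > (0 : ℝ), ∀ V : EuclideanSpace ℝ (Fin n) → ℂ, Measurable V →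
      fpNorm n p V < ⊤ →
      ∀ f : 𝓢(EuclideanSpace ℝ (Fin n), ℂ),
        wtNorm n (fun x => (‖V x‖₊ : ℝ≥0∞)) (fun x t => mOp n (cosMult t) (⇑f) x) ≤
          ENNReal.ofReal C * fpNorm n p V ^ ((1 : ℝ) / 2) *
            eLpNorm (mOp n (powMult (1 / 2)) (⇑f)) 2 volume := by
  have hn3 : (3:ℝ) ≤ n := by exact_mod_cast hn
  have hfr : Module.finrank ℝ (EuclideanSpace ℝ (Fin n)) = n := by simp
  haveI : Nontrivial (EuclideanSpace ℝ (Fin n)) := Module.nontrivial_of_finrank_pos (R := ℝ) (by rw [hfr]; omega)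
  have hp0 : 0 < p := by linarith
  obtain ⟨C, hC, h⟩ := WL.wave (E := EuclideanSpace ℝ (Fin n)) (by rw [hfr]; exact hn) p (by rw [hfr]; exact hp)
  refine ⟨(C + 1) ^ ((1:ℝ)/2), by positivity, ?_⟩
  intro V hV hVf f
  obtain ⟨hS1, hS2⟩ := WL.rhs_eq n f
  set S := ∫⁻ ξ, ENNReal.ofReal ‖ξ‖ * ‖𝓕 (⇑f) ξ‖ₑ^2 with hS
  set A := fpNorm n p V with hA
  unfold wtNorm
  set T := ∫⁻ t : ℝ, ∫⁻ x : EuclideanSpace ℝ (Fin n), (‖mOp n (cosMult t) (⇑f) x‖₊ : ℝ≥0∞) ^ (2 : ℝ) * (‖V x‖₊ : ℝ≥0∞) with hT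
  have hFc : Continuous (𝓕 (⇑f)) := (𝓕 f : 𝓢(EuclideanSpace ℝ (Fin n), ℂ)).continuous
  have hFi : Integrable (𝓕 (⇑f)) := (𝓕 f : 𝓢(EuclideanSpace ℝ (Fin n), ℂ)).integrable
  have key : ∀ N : ℝ, 0 < N → A ≤ ENNReal.ofReal N → T ≤ ENNReal.ofReal (C * N) * S := by
    intro N hN hAN
    have h1 := h (fun x => ‖V x‖) N hV.norm (fun x => norm_nonneg _) hN ?_ (𝓕 (⇑f)) hFc hFi
    · refine le_trans (le_of_eq ?_) h1
      rw [hT]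
      congr 1; ext t; congr 1; ext x
      rw [ENNReal.rpow_two, ofReal_norm]
      rfl
    · intro x r hr
      have := WL.fp_conv n p hp0 V N hN hAN x r hr
      rwa [hfr]
  have hlim : T ≤ ENNReal.ofReal (C * A.toReal) * S := by
    have hcont : Filter.Tendsto (fun ε : ℝ => ENNReal.ofReal (C * (A.toReal + ε)) * S) (nhdsWithin 0 (Set.Ioi 0))
        (nhds (ENNReal.ofReal (C * (A.toReal + 0)) * S)) := by
      apply Filter.Tendsto.mono_left _ nhdsWithin_le_nhds
      have : Continuous (fun ε : ℝ => ENNReal.ofReal (C * (A.toReal + ε)) * S) := by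
        apply (ENNReal.continuous_mul_const hS2).comp
        exact ENNReal.continuous_ofReal.comp (by fun_prop)
      exact this.tendsto 0
    rw [add_zero] at hcont
    refine ge_of_tendsto hcont ?_
    filter_upwards [self_mem_nhdsWithin] with ε hε
    have hε : 0 < ε := hε
    refine key _ (by positivity) ?_
    rw [ENNReal.le_ofReal_iff_toReal_le hVf.ne (by positivity)]
    linarith
  have hfin : T ≤ ENNReal.ofReal (C + 1) * A * S := by
    refine hlim.trans ?_
    rw [ENNReal.ofReal_mul hC, ENNReal.ofReal_toReal hVf.ne]
    gcongr
    linarith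
  calc T ^ ((1:ℝ)/2) ≤ (ENNReal.ofReal (C + 1) * A * S) ^ ((1:ℝ)/2) := by gcongr
    _ = _ := by
      rw [ENNReal.mul_rpow_of_nonneg _ _ (by norm_num), ENNReal.mul_rpow_of_nonneg _ _ (by norm_num),
        ENNReal.ofReal_rpow_of_pos (by positivity), hS1, ← ENNReal.rpow_natCast, ← ENNReal.rpow_mul]
      norm_num

end
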